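/- arXiv:0808.3344 — 3 statements merged into one kernel-verified Lean document; each statement's English description precedes it below -/
import Mathlib

section
/- Let d ≥ 3. There exist constants c, c' > 0 depending only on d such that for every integer L_0 ≥ c' and every n ≥ 0 the following holds. With V and U as below, for every y ∈ V and every z ∈ ∂U ∪ ∂_int U, P_z[H_V < ∞ and X_{H_V} = y] ≤ c·L_{n+1}^{−(d−2)}·e_V(y). -/
open MeasureTheory Filter

namespace RI

/-- Points of `ℤ^d`. -/
abbrev Zd (d : ℕ) := Fin d → ℤ

/-- `x` and `y` are nearest neighbours: `|x - y| = 1`. -/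
def adj {d : ℕ} (x y : Zd d) : Prop := (∑ i, |x i - y i|) = 1

/-- `x` and `y` are `*`-neighbours: `|x - y|_∞ = 1`. -/
def starAdj {d : ℕ} (x y : Zd d) : Prop := x ≠ y ∧ ∀ i, |x i - y i| ≤ 1

/-- `x` belongs to the plane `ℤ e₁ + ℤ e₂ ⊆ ℤ^d`. -/
def inPlane {d : ℕ} (x : Zd d) : Prop := ∀ i : Fin d, 2 ≤ (i : ℕ) → x i = 0

/-- The `k`-th coordinate of `x`, with value `0` for out-of-range indices. -/
def coord {d : ℕ} (x : Zd d) (k : ℕ) : ℤ := if h : k < d then x ⟨k, h⟩ else 0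

/-- `P` is the family of laws of the simple random walks on `ℤ^d` started at the points of
`ℤ^d`: each `P x` is a probability measure on the path space `ℕ → ℤ^d`, and the cylinder
probabilities are those of the walk with i.i.d. increments uniform on `{± e_i}`. -/
def IsSRW (d : ℕ) (P : Zd d → Measure (ℕ → Zd d)) : Prop :=
  (∀ x, IsProbabilityMeasure (P x)) ∧
  (∀ (x : Zd d) (n : ℕ) (w : ℕ → Zd d),
      (w 0 = x ∧ ∀ k < n, adj (w k) (w (k + 1))) →
        P x {ω | ∀ k ≤ n, ω k = w k} = ((2 * d : ENNReal))⁻¹ ^ n) ∧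
  (∀ (x : Zd d) (n : ℕ) (w : ℕ → Zd d),
      ¬(w 0 = x ∧ ∀ k < n, adj (w k) (w (k + 1))) →
        P x {ω | ∀ k ≤ n, ω k = w k} = 0)

/-- The equilibrium measure of a set `V ⊆ ℤ^d`:
`e_V(x) = P_x[H̃_V = ∞]` for `x ∈ V`, and `0` otherwise. -/
noncomputable def eqm {d : ℕ} (P : Zd d → Measure (ℕ → Zd d)) (V : Set (Zd d)) : Zd d → ℝ :=
  V.indicator fun x => (P x {ω | ∀ n, 1 ≤ n → ω n ∉ V}).toReal

/-- The capacity of a finite set `K ⊆ ℤ^d`. -/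
noncomputable def capa {d : ℕ} (P : Zd d → Measure (ℕ → Zd d)) (K : Finset (Zd d)) : ℝ :=
  ∑ x ∈ K, eqm P (↑K) x

/-- `Q` is a vacant-set law at level `u`: a probability measure on `{0,1}^{ℤ^d}`
(with `true = 1` standing for "vacant") such that
`Q[Y_x = 1 ∀ x ∈ K] = exp(-u cap K)` for every finite `K`. -/
def IsVacantLaw {d : ℕ} (P : Zd d → Measure (ℕ → Zd d)) (u : ℝ)
    (Q : Measure (Zd d → Bool)) : Prop :=
  IsProbabilityMeasure Q ∧
  ∀ K : Finset (Zd d),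
    Q {Y | ∀ x ∈ K, Y x = true} = ENNReal.ofReal (Real.exp (-(u * capa P K)))

/-- There is a `*`-path starting in `S`, ending in `T`, all of whose points lie in `A`. -/
def HasStarPath {d : ℕ} (S T A : Set (Zd d)) : Prop :=
  ∃ (N : ℕ) (w : ℕ → Zd d), w 0 ∈ S ∧ w N ∈ T ∧ (∀ k ≤ N, w k ∈ A) ∧
    ∀ k < N, starAdj (w k) (w (k + 1))

/-- Interior boundary `∂_int U`. -/
def intBdry {d : ℕ} (U : Set (Zd d)) : Set (Zd d) := {x | x ∈ U ∧ ∃ y, y ∉ U ∧ adj x y}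

/-- (Exterior) boundary `∂U`. -/
def bdry {d : ℕ} (U : Set (Zd d)) : Set (Zd d) := {x | x ∉ U ∧ ∃ y ∈ U, adj x y}

/-- `ℓ = 100 ⌊L^{1/100}⌋ + 1`. -/
noncomputable def ellOf (L : ℕ) : ℕ := 100 * ⌊(L : ℝ) ^ ((1 : ℝ) / 100)⌋₊ + 1

/-- The scales `L_{n+1} = ℓ_n L_n`. -/
noncomputable def Lseq (L0 : ℕ) : ℕ → ℕ
  | 0 => L0
  | n + 1 => ellOf (Lseq L0 n) * Lseq L0 n

/-- The levels `u_{n+1} = (1 + 1/log L_n)⁻¹ u_n`. -/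
noncomputable def useq (L0 : ℕ) (u0 : ℝ) : ℕ → ℝ
  | 0 => u0
  | n + 1 => (1 + 1 / Real.log (Lseq L0 n))⁻¹ * useq L0 u0 n

/-- The event (on the configuration space `{0,1}^{ℤ^d}`) that there is a `*`-path from
`[-L,L]² ∩ ℤ²` to `∂_int ([-3L,3L]^d ∩ ℤ^d)` all of whose points lie in `{x ∈ ℤ² : Y_x = 0}`. -/
def qEvent (d : ℕ) (L : ℕ) : Set (Zd d → Bool) :=
  {Y | HasStarPath
    {x : Zd d | inPlane x ∧ ∀ i, |x i| ≤ (L : ℤ)}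
    (intBdry {x : Zd d | ∀ i, |x i| ≤ (3 * L : ℤ)})
    {x : Zd d | inPlane x ∧ Y x = false}}


/-- The embedding of `ℤ²` into `ℤ^d`. -/
def embPlane (d : ℕ) (i : ℤ × ℤ) : Zd d :=
  fun j => if (j : ℕ) = 0 then i.1 else if (j : ℕ) = 1 then i.2 else 0

/-- `V = (([-3Lₙ,3Lₙ]^d + 2Lₙ i₁) ∪ ([-3Lₙ,3Lₙ]^d + 2Lₙ i₂)) ∩ ℤ^d`. -/
def twoBoxV (d : ℕ) (Ln : ℕ) (i1 i2 : ℤ × ℤ) : Set (Zd d) :=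
  {x | ∀ j, |x j - 2 * (Ln : ℤ) * embPlane d i1 j| ≤ 3 * (Ln : ℤ)} ∪
  {x | ∀ j, |x j - 2 * (Ln : ℤ) * embPlane d i2 j| ≤ 3 * (Ln : ℤ)}

/-- `U = {z : d(z,V) ≤ L_{n+1}/10}`, the `ℓ^∞`-neighbourhood of `V` of size `L_{n+1}/10`. -/
def nbhdU (d : ℕ) (L1 : ℕ) (V : Set (Zd d)) : Set (Zd d) :=
  {z | ∃ v ∈ V, ∀ j, 10 * |z j - v j| ≤ (L1 : ℤ)}

end RI

open RI MeasureTheory Filter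

open scoped ENNReal Topology

namespace RI

variable {d : ℕ}

/-- The average of `f` over the `2d` nearest neighbours of `x`. -/
noncomputable def avg (f : Zd d → ℝ≥0∞) (x : Zd d) : ℝ≥0∞ :=
  (2 * d : ℝ≥0∞)⁻¹ * ∑ i, (f (x + Pi.single i 1) + f (x - Pi.single i 1))

lemma adj_iff (x y : Zd d) :
    adj x y ↔ ∃ i, y = x + Pi.single i 1 ∨ y = x - Pi.single i 1 := by
  constructor
  · intro h
    have hne : ∃ i, |x i - y i| ≠ 0 := by
      by_contra! h0
      simp [adj, h0] at h
    obtain ⟨i, hi⟩ := hne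
    have hsplit := Finset.add_sum_erase Finset.univ (fun j => |x j - y j|) (Finset.mem_univ i)
    have hpos : 0 < |x i - y i| := lt_of_le_of_ne (abs_nonneg _) (Ne.symm hi)
    have hrest : 0 ≤ ∑ j ∈ Finset.univ.erase i, |x j - y j| :=
      Finset.sum_nonneg fun _ _ => abs_nonneg _
    unfold adj at h
    rw [h] at hsplit
    have h0 : ∑ j ∈ Finset.univ.erase i, |x j - y j| = 0 := by omega
    have h1 : |x i - y i| = 1 := by omega
    have hz : ∀ j, j ≠ i → x j = y j := by
      intro j hj
      have := (Finset.sum_eq_zero_iff_of_nonneg (fun _ _ => abs_nonneg _)).1 h0 j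
        (by simp [hj])
      rw [abs_eq_zero] at this
      omega
    refine ⟨i, ?_⟩
    rcases (abs_eq (by norm_num : (0 : ℤ) ≤ 1)).1 h1 with h2 | h2
    · right
      ext j
      by_cases hj : j = i
      · subst hj; simp; omega
      · simp [hj, hz j hj]
    · left
      ext j
      by_cases hj : j = i
      · subst hj; simp; omega
      · simp [hj, hz j hj]
  · rintro ⟨i, rfl | rfl⟩ <;> simp [adj, Pi.single_apply, apply_ite abs]

lemma adj_add (x : Zd d) (i : Fin d) : adj x (x + Pi.single i 1) :=
  (adj_iff _ _).2 ⟨i, .inl rfl⟩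

lemma adj_sub (x : Zd d) (i : Fin d) : adj x (x - Pi.single i 1) :=
  (adj_iff _ _).2 ⟨i, .inr rfl⟩

lemma avg_mono {f g : Zd d → ℝ≥0∞} {x : Zd d} (h : ∀ y, adj x y → f y ≤ g y) :
    avg f x ≤ avg g x := by
  unfold avg
  gcongr with i
  · exact h _ (adj_add x i)
  · exact h _ (adj_sub x i)

lemma avg_congr {f g : Zd d → ℝ≥0∞} {x : Zd d} (h : ∀ y, adj x y → f y = g y) :
    avg f x = avg g x :=
  le_antisymm (avg_mono fun y hy => (h y hy).le) (avg_mono fun y hy => (h y hy).ge)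

lemma avg_const (hd : d ≠ 0) (c : ℝ≥0∞) (x : Zd d) : avg (fun _ => c) x = c := by
  have h0 : (2 * d : ℝ≥0∞) ≠ 0 := by simp [hd]
  have ht : (2 * d : ℝ≥0∞) ≠ ∞ := by finiteness
  simp only [avg, Finset.sum_const, Finset.card_univ, Fintype.card_fin, nsmul_eq_mul]
  rw [← two_mul, ← mul_assoc, ← mul_assoc, mul_assoc _ (d : ℝ≥0∞) 2, mul_comm (d : ℝ≥0∞) 2,
    ENNReal.inv_mul_cancel h0 ht, one_mul]

lemma avg_add (f g : Zd d → ℝ≥0∞) (x : Zd d) :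
    avg (fun y => f y + g y) x = avg f x + avg g x := by
  simp only [avg, ← mul_add, ← Finset.sum_add_distrib]
  congr 1
  exact Finset.sum_congr rfl fun i _ => by ring

lemma avg_const_mul (c : ℝ≥0∞) (f : Zd d → ℝ≥0∞) (x : Zd d) :
    avg (fun y => c * f y) x = c * avg f x := by
  simp only [avg, ← mul_add, ← Finset.mul_sum]
  ring

lemma avg_tsum (f : ℕ → Zd d → ℝ≥0∞) (x : Zd d) :
    avg (fun y => ∑' n, f n y) x = ∑' n, avg (f n) x := by
  simp only [avg, ENNReal.tsum_mul_left, ← ENNReal.tsum_add]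
  rw [Summable.tsum_finsetSum fun _ _ => ENNReal.summable]

lemma avg_sub_right (f : Zd d → ℝ≥0∞) (a x : Zd d) :
    avg (fun y => f (y - a)) x = avg f (x - a) := by
  unfold avg
  congr 1
  refine Finset.sum_congr rfl fun i _ => ?_
  simp only [add_sub_right_comm x _ a, sub_right_comm x _ a]

lemma avg_ite (x v : Zd d) (c : ℝ≥0∞) [Decidable (adj x v)] :
    avg (fun y => if y = v then c else 0) x = if adj x v then (2 * d : ℝ≥0∞)⁻¹ * c else 0 := by
  split_ifs with h
  · unfold avg
    congr 1
    obtain ⟨i, hi⟩ := (adj_iff _ _).1 h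
    rw [Finset.sum_eq_single i]
    · rcases hi with rfl | rfl
      · have : ¬ (x - Pi.single i 1 = x + Pi.single i 1) := by
          intro h
          have := congrFun h i
          simp at this
          omega
        simp [this]
      · have : ¬ (x + Pi.single i 1 = x - Pi.single i 1) := by
          intro h
          have := congrFun h i
          simp at this
          omega
        simp [this]
    · intro j _ hj
      have key : x + Pi.single j 1 ≠ v ∧ x - Pi.single j 1 ≠ v := by
        constructor <;> intro h <;> have := congrFun h j <;> rcases hi with rfl | rfl <;>
          simp [hj] at this
      simp [key.1, key.2]
    · simp
  · rw [avg_congr (g := fun _ => 0)]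
    · simp [avg]
    · intro y hy
      rw [if_neg]
      rintro rfl
      exact h hy

lemma tsum_mul_avg (f g : Zd d → ℝ≥0∞) : ∑' x, f x * avg g x = ∑' x, avg f x * g x := by
  have h1 (a : Zd d) : ∑' x, f x * g (x + a) = ∑' x, f (x - a) * g x := by
    rw [← (Equiv.addRight a).tsum_eq fun x => f (x - a) * g x]
    simp
  have h2 (a : Zd d) : ∑' x, f x * g (x - a) = ∑' x, f (x + a) * g x := by
    simpa [sub_eq_add_neg] using h1 (-a)
  have e1 (x) : f x * avg g x = (2 * d : ℝ≥0∞)⁻¹ *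
      ∑ i, (f x * g (x + Pi.single i 1) + f x * g (x - Pi.single i 1)) := by
    simp only [avg, ← mul_add, ← Finset.mul_sum]
    ring
  have e2 (x) : avg f x * g x = (2 * d : ℝ≥0∞)⁻¹ *
      ∑ i, (f (x - Pi.single i 1) * g x + f (x + Pi.single i 1) * g x) := by
    simp only [avg, ← add_mul, ← Finset.sum_mul, add_comm (f (x - _))]
    ring
  simp only [e1, e2, ENNReal.tsum_mul_left]
  rw [Summable.tsum_finsetSum fun _ _ => ENNReal.summable,
    Summable.tsum_finsetSum fun _ _ => ENNReal.summable]
  simp only [ENNReal.tsum_add, h1, h2]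

/-- The path that starts at `x` and then follows `ω`. -/
def pathCons (x : Zd d) (ω : ℕ → Zd d) : ℕ → Zd d
  | 0 => x
  | k + 1 => ω k

lemma measurable_pathCons (x : Zd d) : Measurable (pathCons x) := by
  refine measurable_pi_lambda _ fun k => ?_
  cases k with
  | zero => exact measurable_const
  | succ k => exact measurable_pi_apply k

/-- The paths that agree with `w` up to time `n`. -/
def cyl (n : ℕ) (w : ℕ → Zd d) : Set (ℕ → Zd d) := {ω | ∀ k ≤ n, ω k = w k}

lemma measurableSet_cyl (n : ℕ) (w : ℕ → Zd d) : MeasurableSet (cyl n w) := by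
  simp only [cyl, Set.ofPred_forall]
  refine MeasurableSet.iInter fun k => MeasurableSet.iInter fun _ => ?_
  exact measurable_pi_apply (X := fun _ : ℕ => Zd d) k (measurableSet_singleton (w k))

lemma isPiSystem_cyl : IsPiSystem {S : Set (ℕ → Zd d) | ∃ n w, S = cyl n w} := by
  rintro _ ⟨n, w, rfl⟩ _ ⟨m, v, rfl⟩ ⟨u, hu, hv⟩
  refine ⟨max n m, u, ?_⟩
  ext ω
  constructor
  · rintro ⟨h1, h2⟩ k hk
    rcases le_max_iff.1 hk with h | h
    · rw [h1 k h, hu k h]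
    · rw [h2 k h, hv k h]
  · intro h
    exact ⟨fun k hk => (h k (le_max_of_le_left hk)).trans (hu k hk),
      fun k hk => (h k (le_max_of_le_right hk)).trans (hv k hk)⟩

lemma generateFrom_cyl : (inferInstance : MeasurableSpace (ℕ → Zd d)) =
    MeasurableSpace.generateFrom {S : Set (ℕ → Zd d) | ∃ n w, S = cyl n w} := by
  apply le_antisymm
  · refine iSup_le fun k => ?_
    rintro _ ⟨S, -, rfl⟩
    have : (fun ω : ℕ → Zd d => ω k) ⁻¹' S = ⋃ v : {v : Fin (k + 1) → Zd d // v (Fin.last k) ∈ S},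
        cyl k (fun j => if h : j < k + 1 then v.1 ⟨j, h⟩ else 0) := by
      ext ω
      simp only [Set.mem_preimage, Set.mem_iUnion]
      constructor
      · intro h
        refine ⟨⟨fun j => ω j, h⟩, fun j hj => ?_⟩
        simp [Nat.lt_succ_of_le hj]
      · rintro ⟨v, hv⟩
        have := hv k le_rfl
        simp only [Nat.lt_succ_self, dite_true] at this
        rw [this]
        exact v.2
    rw [this]
    exact MeasurableSet.iUnion fun v => MeasurableSpace.measurableSet_generateFrom ⟨_, _, rfl⟩
  · apply MeasurableSpace.generateFrom_le
    rintro _ ⟨n, w, rfl⟩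
    exact measurableSet_cyl n w

section Walk

variable {P : Zd d → Measure (ℕ → Zd d)}

lemma IsSRW.measure_cyl_succ (hP : IsSRW d P) (x : Zd d) (n : ℕ) (w : ℕ → Zd d) :
    P x (cyl (n + 1) w) = avg (fun y => P y (pathCons x ⁻¹' cyl (n + 1) w)) x := by
  classical
  have hset (y : Zd d) : P y (pathCons x ⁻¹' cyl (n + 1) w) =
      if w 0 = x ∧ ∀ k < n, adj (w (k + 1)) (w (k + 2)) then
        if y = w 1 then (2 * d : ℝ≥0∞)⁻¹ ^ n else 0 else 0 := by
    by_cases h0 : w 0 = x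
    · have hpre : pathCons x ⁻¹' cyl (n + 1) w = {ω | ∀ k ≤ n, ω k = w (k + 1)} := by
        ext ω
        constructor
        · intro h k hk
          exact h (k + 1) (by omega)
        · rintro h (_ | k) hk
          · exact h0.symm
          · exact h k (by omega)
      rw [hpre]
      by_cases h : (w 1 = y ∧ ∀ k < n, adj (w (k + 1)) (w (k + 2)))
      · rw [hP.2.1 y n (fun k => w (k + 1)) h, if_pos ⟨h0, h.2⟩, if_pos h.1.symm]
      · rw [hP.2.2 y n (fun k => w (k + 1)) h]
        split_ifs with h1 h2
        · exact absurd ⟨h2.symm, h1.2⟩ h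
        · rfl
        · rfl
    · have hpre : pathCons x ⁻¹' cyl (n + 1) w = ∅ := by
        ext ω
        simp only [Set.mem_preimage, Set.mem_empty_iff_false, iff_false]
        intro h
        exact h0 (h 0 (by omega)).symm
      simp [hpre, h0]
  simp only [hset]
  by_cases h : (w 0 = x ∧ ∀ k < n + 1, adj (w k) (w (k + 1)))
  · have h1 : w 0 = x ∧ ∀ k < n, adj (w (k + 1)) (w (k + 2)) :=
      ⟨h.1, fun k hk => h.2 (k + 1) (by omega)⟩
    have h2 : adj x (w 1) := h.1 ▸ h.2 0 (by omega)
    simp only [if_pos h1]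
    rw [avg_ite, if_pos h2, ← pow_succ']
    exact hP.2.1 x (n + 1) w h
  · have h0 : P x (cyl (n + 1) w) = 0 := hP.2.2 x (n + 1) w h
    rw [h0]
    by_cases h1 : w 0 = x ∧ ∀ k < n, adj (w (k + 1)) (w (k + 2))
    · have h2 : ¬ adj x (w 1) := by
        intro h2
        refine h ⟨h1.1, ?_⟩
        rintro (_ | k) hk
        · rw [h1.1]; exact h2
        · exact h1.2 k (by omega)
      simp only [if_pos h1]
      rw [avg_ite, if_neg h2]
    · simp only [if_neg h1]
      simp [avg]

lemma IsSRW.measure_cyl_zero (hd : d ≠ 0) (hP : IsSRW d P) (x : Zd d) (w : ℕ → Zd d) :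
    P x (cyl 0 w) = avg (fun y => P y (pathCons x ⁻¹' cyl 0 w)) x := by
  by_cases h : w 0 = x
  · have hpre : pathCons x ⁻¹' cyl 0 w = Set.univ := by
      ext ω
      simp [cyl, pathCons, h]
    have h1 : P x (cyl 0 w) = 1 := by
      rw [cyl, hP.2.1 x 0 w ⟨h, by simp⟩, pow_zero]
    have h2 (y) : P y Set.univ = 1 := (hP.1 y).measure_univ
    simp only [hpre, h1, h2, avg_const hd]
  · have hpre : pathCons x ⁻¹' cyl 0 w = ∅ := by
      ext ω
      simp [cyl, pathCons, Ne.symm h]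
    have h1 : P x (cyl 0 w) = 0 := hP.2.2 x 0 w (fun h' => h h'.1)
    simp [hpre, h1, avg]

/-- The Markov property at time `1`. -/
lemma IsSRW.first_step (hd : d ≠ 0) (hP : IsSRW d P) (x : Zd d) {B : Set (ℕ → Zd d)}
    (hB : MeasurableSet B) : P x B = avg (fun y => P y (pathCons x ⁻¹' B)) x := by
  have := hP.1
  let ν : Measure (ℕ → Zd d) := (2 * d : ℝ≥0∞)⁻¹ • ∑ i,
    ((P (x + Pi.single i 1)).map (pathCons x) + (P (x - Pi.single i 1)).map (pathCons x))
  have hν {S : Set (ℕ → Zd d)} (hS : MeasurableSet S) :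
      ν S = avg (fun y => P y (pathCons x ⁻¹' S)) x := by
    simp [ν, avg, Measure.map_apply (measurable_pathCons x) hS, Measure.finsetSum_apply]
  have heq : P x = ν := by
    refine ext_of_generate_finite _ generateFrom_cyl isPiSystem_cyl ?_ ?_
    · rintro _ ⟨n, w, rfl⟩
      rw [hν (measurableSet_cyl n w)]
      cases n with
      | zero => exact hP.measure_cyl_zero hd x w
      | succ n => exact hP.measure_cyl_succ x n w
    · rw [hν MeasurableSet.univ]
      simp [avg_const hd]
  rw [← hν hB, ← heq]

lemma measurableSet_coord (k : ℕ) (S : Set (Zd d)) :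
    MeasurableSet {ω : ℕ → Zd d | ω k ∈ S} :=
  measurable_pi_apply k (S.to_countable.measurableSet)

lemma measurableSet_avoid (V : Set (Zd d)) :
    MeasurableSet {ω : ℕ → Zd d | ∀ n, ω n ∉ V} := by
  rw [Set.ofPred_forall]
  exact MeasurableSet.iInter fun n => measurableSet_coord n Vᶜ

/-- The probability of never visiting `V`. -/
noncomputable def escape (P : Zd d → Measure (ℕ → Zd d)) (V : Set (Zd d)) (x : Zd d) : ℝ≥0∞ :=
  P x {ω | ∀ n, ω n ∉ V}

lemma escape_eq_avg (hd : d ≠ 0) (hP : IsSRW d P) {V : Set (Zd d)} {x : Zd d} (hx : x ∉ V) :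
    escape P V x = avg (escape P V) x := by
  unfold escape
  rw [hP.first_step hd x (measurableSet_avoid V)]
  congr with y
  congr with ω
  constructor
  · intro h n
    exact h (n + 1)
  · rintro h (_ | n)
    · exact hx
    · exact h n

lemma eqm_eq_avg (hd : d ≠ 0) (hP : IsSRW d P) {V : Set (Zd d)} {y : Zd d} (hy : y ∈ V) :
    eqm P V y = (avg (escape P V) y).toReal := by
  have hm : MeasurableSet {ω : ℕ → Zd d | ∀ n, 1 ≤ n → ω n ∉ V} := by
    simp only [Set.ofPred_forall]
    exact MeasurableSet.iInter fun n => MeasurableSet.iInter fun _ => measurableSet_coord n Vᶜ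
  rw [eqm, Set.indicator_of_mem hy, hP.first_step hd y hm]
  unfold escape
  congr with x
  congr with ω
  constructor
  · intro h n
    exact h (n + 1) (by omega)
  · rintro h (_ | n) hn
    · omega
    · exact h n

/-- The probability that the walk enters `V` at time `n` in the point `y`. -/
noncomputable def hitAt (P : Zd d → Measure (ℕ → Zd d)) (V : Set (Zd d)) (y : Zd d) (n : ℕ)
    (x : Zd d) : ℝ≥0∞ :=
  P x {ω | ω n = y ∧ ∀ k < n, ω k ∉ V}

lemma hitAt_zero (hP : IsSRW d P) (V : Set (Zd d)) (x y : Zd d) [Decidable (x = y)] :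
    hitAt P V y 0 x = if x = y then 1 else 0 := by
  have hset : {ω : ℕ → Zd d | ω 0 = y ∧ ∀ k < 0, ω k ∉ V} =
      {ω | ∀ k ≤ 0, ω k = (fun _ : ℕ => y) k} := by
    ext ω
    simp
  rw [hitAt, hset]
  split_ifs with h
  · simpa only [pow_zero] using hP.2.1 x 0 (fun _ => y) ⟨h.symm, by simp⟩
  · exact hP.2.2 x 0 (fun _ => y) fun h' => h h'.1.symm

lemma hitAt_succ_of_mem (V : Set (Zd d)) (y : Zd d) (n : ℕ) (hP : IsSRW d P) {x : Zd d}
    (hx : x ∈ V) : hitAt P V y (n + 1) x = 0 := by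
  classical
  have h0 := hitAt_zero hP ∅ x x
  have := hP.1 x
  rw [if_pos rfl] at h0
  have hm : MeasurableSet {ω : ℕ → Zd d | ω 0 = x ∧ ∀ k < 0, ω k ∉ (∅ : Set (Zd d))} := by
    simpa using measurableSet_coord 0 {x}
  refine measure_mono_null ?_ ((prob_compl_eq_zero_iff hm).2 h0)
  rintro ω ⟨-, h⟩ ⟨h', -⟩
  exact h 0 (by omega) (h' ▸ hx)

lemma hitAt_succ (hd : d ≠ 0) (hP : IsSRW d P) {V : Set (Zd d)} (y : Zd d) (n : ℕ) {x : Zd d}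
    (hx : x ∉ V) : hitAt P V y (n + 1) x = avg (hitAt P V y n) x := by
  unfold hitAt
  rw [hP.first_step hd x]
  · congr with x'
    congr with ω
    constructor
    · rintro ⟨h1, h2⟩
      exact ⟨h1, fun k hk => h2 (k + 1) (by omega)⟩
    · rintro ⟨h1, h2⟩
      refine ⟨h1, ?_⟩
      rintro (_ | k) hk
      · exact hx
      · exact h2 k (by omega)
  · rw [Set.ofPred_and]
    refine (measurableSet_coord (n + 1) {y}).inter ?_
    simp only [Set.ofPred_forall]
    exact MeasurableSet.iInter fun k => MeasurableSet.iInter fun _ => measurableSet_coord k Vᶜ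

open Classical in
/-- The `n`-step kernel of the walk killed on `V`, as a function of its second argument. -/
noncomputable def killed (V : Set (Zd d)) (z : Zd d) : ℕ → Zd d → ℝ≥0∞
  | 0, x => if x = z then 1 else 0
  | n + 1, x => if x ∈ V then 0 else avg (killed V z n) x

lemma killed_of_mem {V : Set (Zd d)} {z : Zd d} (hz : z ∉ V) (n : ℕ) {x : Zd d} (hx : x ∈ V) :
    killed V z n x = 0 := by
  cases n with
  | zero =>
    rw [killed, if_neg]
    rintro rfl
    exact hz hx
  | succ n => rw [killed, if_pos hx]

lemma tsum_killed_mul_hitAt (hd : d ≠ 0) (hP : IsSRW d P) {V : Set (Zd d)} {z : Zd d} (hz : z ∉ V)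
    (y : Zd d) (i j : ℕ) :
    ∑' x, killed V z j x * hitAt P V y (i + 1) x = avg (killed V z (i + j)) y := by
  classical
  have h1 (i j : ℕ) : ∑' x, killed V z j x * hitAt P V y (i + 1) x =
      ∑' x, avg (killed V z j) x * hitAt P V y i x := by
    rw [← tsum_mul_avg]
    refine tsum_congr fun x => ?_
    by_cases hx : x ∈ V
    · simp [killed_of_mem hz j hx]
    · rw [hitAt_succ hd hP y i hx]
  induction i generalizing j with
  | zero =>
    rw [h1, zero_add, tsum_eq_single y]
    · simp [hitAt_zero hP]
    · intro x hx
      simp [hitAt_zero hP, hx]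
  | succ i ih =>
    rw [h1, Nat.add_right_comm, add_assoc, ← ih]
    refine tsum_congr fun x => ?_
    by_cases hx : x ∈ V
    · simp [hitAt_succ_of_mem V y i hP hx]
    · rw [killed, if_neg hx]

lemma tsum_killed_le {V : Set (Zd d)} {z : Zd d} {s : Zd d → ℝ≥0∞}
    (hs : ∀ x ∉ V, avg s x ≤ s x) (hz : z ∉ V) (hsz : 1 + avg s z ≤ s z) (x : Zd d) :
    ∑' n, killed V z n x ≤ s x := by
  refine ENNReal.tsum_le_of_sum_range_le fun N => ?_
  induction N generalizing x with
  | zero => simp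
  | succ N ih =>
    by_cases hx : x ∈ V
    · simp [killed_of_mem hz _ hx]
    · have hsum : ∑ n ∈ Finset.range N, killed V z (n + 1) x ≤ avg s x := by
        calc ∑ n ∈ Finset.range N, killed V z (n + 1) x
            = avg (fun x' => ∑ n ∈ Finset.range N, killed V z n x') x := by
              simp only [killed, if_neg hx]
              simp only [avg, ← Finset.mul_sum, ← Finset.sum_add_distrib]
              rw [Finset.sum_comm]
          _ ≤ avg s x := avg_mono fun x' _ => ih x'
      rw [Finset.sum_range_succ', add_comm]
      by_cases hxz : x = z
      · subst hxz
        refine le_trans (add_le_add ?_ hsum) hsz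
        simp [killed]
      · refine le_trans (add_le_add ?_ (hsum.trans (hs x hx))) (zero_add _).le
        simp [killed, hxz]

/-- A supersolution for the killed Green function with pole `z` bounds the entrance law
of the walk started at `z`. -/
lemma measure_entrance_le (hd : d ≠ 0) (hP : IsSRW d P) {V : Set (Zd d)} {y z : Zd d}
    (hy : y ∈ V) (hz : z ∉ V) {s : Zd d → ℝ≥0∞}
    (hs : ∀ x ∉ V, avg s x ≤ s x) (hsz : 1 + avg s z ≤ s z) :
    P z {ω | ∃ m : ℕ, ω m = y ∧ ∀ k < m, ω k ∉ V} ≤ avg s y := by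
  classical
  have hne : z ≠ y := fun h => hz (h ▸ hy)
  calc P z {ω | ∃ m : ℕ, ω m = y ∧ ∀ k < m, ω k ∉ V}
      ≤ ∑' m, hitAt P V y m z := by
        rw [Set.ofPred_exists]
        exact measure_iUnion_le _
    _ = ∑' m, hitAt P V y (m + 1) z := by
        rw [tsum_eq_zero_add' ENNReal.summable, hitAt_zero hP, if_neg hne, zero_add]
    _ = ∑' m, avg (killed V z m) y := by
        refine tsum_congr fun m => ?_
        rw [← add_zero m, ← tsum_killed_mul_hitAt hd hP hz, tsum_eq_single z]
        · simp [killed]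
        · intro x hx
          simp [killed, hx]
    _ = avg (fun x => ∑' m, killed V z m x) y := (avg_tsum _ _).symm
    _ ≤ avg s y := avg_mono fun x _ => tsum_killed_le hs hz hsz x

/-- A supersolution that is at least `1` on `V` bounds the hitting probability of `V`. -/
lemma one_le_escape_add (hd : d ≠ 0) (hP : IsSRW d P) {V : Set (Zd d)} {s : Zd d → ℝ≥0∞}
    (hs : ∀ x ∉ V, avg s x ≤ s x) (hV : ∀ x ∈ V, 1 ≤ s x) (x : Zd d) :
    1 ≤ escape P V x + s x := by
  have hstep (N : ℕ) (x : Zd d) : 1 ≤ P x {ω | ∀ n < N, ω n ∉ V} + s x := by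
    induction N generalizing x with
    | zero =>
      have := hP.1 x
      simp
    | succ N ih =>
      by_cases hx : x ∈ V
      · exact (hV x hx).trans le_add_self
      · have hm : MeasurableSet {ω : ℕ → Zd d | ∀ n < N + 1, ω n ∉ V} := by
          simp only [Set.ofPred_forall]
          exact MeasurableSet.iInter fun n => MeasurableSet.iInter fun _ => measurableSet_coord n Vᶜ
        have hpre : pathCons x ⁻¹' {ω | ∀ n < N + 1, ω n ∉ V} = {ω | ∀ n < N, ω n ∉ V} := by
          ext ω
          constructor
          · intro h n hn
            exact h (n + 1) (by omega)
          · rintro h (_ | n) hn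
            · exact hx
            · exact h n (by omega)
        rw [hP.first_step hd x hm, hpre]
        calc (1 : ℝ≥0∞) = avg (fun _ => 1) x := (avg_const hd 1 x).symm
          _ ≤ avg (fun y => P y {ω | ∀ n < N, ω n ∉ V} + s y) x := avg_mono fun y _ => ih y
          _ ≤ _ := by
            rw [avg_add]
            exact add_le_add le_rfl (hs x hx)
  have hlim : Tendsto (fun N => P x {ω | ∀ n < N, ω n ∉ V} + s x) atTop
      (𝓝 (escape P V x + s x)) := by
    refine Tendsto.add_const _ ?_
    have := hP.1 x
    have hI : {ω : ℕ → Zd d | ∀ n, ω n ∉ V} = ⋂ N, {ω | ∀ n < N, ω n ∉ V} := by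
      ext ω
      simp only [Set.mem_iInter]
      exact ⟨fun h N n _ => h n, fun h n => h (n + 1) n (by omega)⟩
    rw [escape, hI]
    refine tendsto_measure_iInter_atTop (fun N => ?_) ?_ ⟨0, measure_ne_top _ _⟩
    · simp only [Set.ofPred_forall]
      exact (MeasurableSet.iInter fun n =>
        MeasurableSet.iInter fun _ => measurableSet_coord n Vᶜ).nullMeasurableSet
    · intro M N hMN ω h n hn
      exact h n (by omega)
  exact ge_of_tendsto' hlim fun N => hstep N x

end Walk

/-- Fourth-order Taylor bound for `(1 + u) ^ a` near `u = 0`. -/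
lemma one_add_rpow_le (a : ℝ) : ∃ C δ : ℝ, 0 < C ∧ 0 < δ ∧ ∀ u : ℝ, |u| ≤ δ →
    (1 + u) ^ a ≤ 1 + a * u + a * (a - 1) / 2 * u ^ 2 + a * (a - 1) * (a - 2) / 6 * u ^ 3
      + C * u ^ 4 := by
  have h := (Real.one_add_rpow_hasFPowerSeriesAt_zero (a := a)).isBigO_sub_partialSum_pow 4
  obtain ⟨C, hC, h⟩ := h.exists_pos
  rw [Asymptotics.IsBigOWith] at h
  obtain ⟨ε, hε, h⟩ := Metric.eventually_nhds_iff.1 h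
  refine ⟨C, ε / 2, hC, by positivity, fun u hu => ?_⟩
  have h1 := h (y := u) (by rw [dist_zero_right, Real.norm_eq_abs]; linarith)
  have hps : (binomialSeries ℝ a).partialSum 4 u =
      1 + a * u + a * (a - 1) / 2 * u ^ 2 + a * (a - 1) * (a - 2) / 6 * u ^ 3 := by
    have h2 : Polynomial.smeval (2 : Polynomial ℤ) a = 2 := by
      simpa using Polynomial.smeval_natCast ℤ a 2
    simp [FormalMultilinearSeries.partialSum, Finset.sum_range_succ, binomialSeries,
      FormalMultilinearSeries.coeff_ofScalars,
      Ring.choose_eq_smul, descPochhammer_succ_right, Polynomial.smeval_mul, Polynomial.smeval_sub,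
      Nat.factorial, h2]
    ring
  rw [zero_add, hps] at h1
  simp only [Real.norm_eq_abs, abs_pow, abs_abs] at h1
  have h2 := (abs_le.1 h1).2
  rw [← abs_pow, abs_of_nonneg (by positivity : 0 ≤ u ^ 4)] at h2
  linarith

/-- The regularised power `(|x|² + A) ^ (-p)` of the Euclidean norm. -/
noncomputable def pot (A p : ℝ) (x : Zd d) : ℝ := (∑ i, (x i : ℝ) ^ 2 + A) ^ (-p)

lemma sum_sq_add_single (x : Zd d) (i : Fin d) :
    ∑ j, (((x + Pi.single i 1 : Zd d) j : ℤ) : ℝ) ^ 2 = ∑ j, (x j : ℝ) ^ 2 + 1 + 2 * x i := by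
  have h (j : Fin d) : (((x + Pi.single i 1 : Zd d) j : ℤ) : ℝ) ^ 2 =
      (x j : ℝ) ^ 2 + if j = i then 1 + 2 * (x i : ℝ) else 0 := by
    by_cases hj : j = i
    · subst hj; simp; ring
    · simp [hj]
  simp only [h, Finset.sum_add_distrib, Finset.sum_ite_eq', Finset.mem_univ, if_true]
  ring

lemma sum_sq_sub_single (x : Zd d) (i : Fin d) :
    ∑ j, (((x - Pi.single i 1 : Zd d) j : ℤ) : ℝ) ^ 2 = ∑ j, (x j : ℝ) ^ 2 + 1 - 2 * x i := by
  have h (j : Fin d) : (((x - Pi.single i 1 : Zd d) j : ℤ) : ℝ) ^ 2 =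
      (x j : ℝ) ^ 2 + if j = i then 1 - 2 * (x i : ℝ) else 0 := by
    by_cases hj : j = i
    · subst hj; simp; ring
    · simp [hj]
  simp only [h, Finset.sum_add_distrib, Finset.sum_ite_eq', Finset.mem_univ, if_true]
  ring

/-- For large `A`, the function `(|x|² + A) ^ (-(d - 2) / 2)` is superharmonic on `ℤ^d`. -/
lemma exists_superharmonic (hd : 3 ≤ d) : ∃ A : ℝ, 1 ≤ A ∧ ∀ x : Zd d,
    ∑ i, (pot A (((d : ℝ) - 2) / 2) (x + Pi.single i 1) +
      pot A (((d : ℝ) - 2) / 2) (x - Pi.single i 1)) ≤ 2 * d * pot A (((d : ℝ) - 2) / 2) x := by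
  obtain ⟨p, hp⟩ : ∃ p : ℝ, p = ((d : ℝ) - 2) / 2 := ⟨_, rfl⟩
  rw [← hp]
  have hd' : (3 : ℝ) ≤ d := by exact_mod_cast hd
  have hp0 : 0 < p := by rw [hp]; linarith
  obtain ⟨C, δ, hC, hδ, hT⟩ := one_add_rpow_le (-p)
  obtain ⟨A, hA1, hA2, hA3⟩ : ∃ A : ℝ, 1 ≤ A ∧ 8 / δ ^ 2 ≤ A ∧
      p * (p + 1) * d + C * (2 * d + 80) ≤ 4 * A * (p * (p + 1)) := by
    refine ⟨1 + 8 / δ ^ 2 + (p * (p + 1) * d + C * (2 * d + 80)) / (p * (p + 1)), ?_, ?_, ?_⟩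
    · have : 0 ≤ 8 / δ ^ 2 + (p * (p + 1) * d + C * (2 * d + 80)) / (p * (p + 1)) := by positivity
      linarith
    · have : 0 ≤ (p * (p + 1) * d + C * (2 * d + 80)) / (p * (p + 1)) := by positivity
      linarith
    · have h1 : 0 ≤ 8 / δ ^ 2 * (p * (p + 1)) := by positivity
      have h2 : (p * (p + 1) * d + C * (2 * d + 80)) / (p * (p + 1)) * (p * (p + 1)) =
          p * (p + 1) * d + C * (2 * d + 80) := div_mul_cancel₀ _ (by positivity)
      have h3 : 0 ≤ p * (p + 1) * d + C * (2 * d + 80) := by positivity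
      have h4 : 0 ≤ p * (p + 1) := by positivity
      nlinarith
  refine ⟨A, hA1, fun x => ?_⟩
  obtain ⟨S, hS⟩ : ∃ S, S = ∑ i, (x i : ℝ) ^ 2 := ⟨_, rfl⟩
  have hS0 : 0 ≤ S := hS ▸ Finset.sum_nonneg fun i _ => sq_nonneg _
  obtain ⟨R, hR⟩ : ∃ R, R = S + A := ⟨_, rfl⟩
  have hR1 : 1 ≤ R := by linarith
  have hR0 : 0 < R := by linarith
  have hle (i : Fin d) : (x i : ℝ) ^ 2 ≤ S := hS ▸
    Finset.single_le_sum (f := fun i => (x i : ℝ) ^ 2) (fun i _ => sq_nonneg _) (Finset.mem_univ i)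
  have hu (v : ℝ) (hv : v ^ 2 ≤ S) : |(1 + 2 * v) / R| ≤ δ := by
    apply abs_le_of_sq_le_sq _ hδ.le
    rw [div_pow, div_le_iff₀ (by positivity)]
    have h8 : 8 ≤ δ ^ 2 * R := by
      rw [div_le_iff₀ (by positivity)] at hA2
      nlinarith [sq_nonneg δ]
    nlinarith [sq_nonneg (1 - 2 * v)]
  have hterm (i : Fin d) : pot A p (x + Pi.single i 1) + pot A p (x - Pi.single i 1) ≤
      R ^ (-p) * (2 - 2 * p / R + p * (p + 1) * (1 + 4 * (x i : ℝ) ^ 2) / R ^ 2 +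
        C * (2 + 48 * (x i : ℝ) ^ 2 + 32 * (x i : ℝ) ^ 4) / R ^ 4) := by
    have hpos (v : ℝ) (hv : v ^ 2 ≤ S) : 0 ≤ 1 + (1 + 2 * v) / R := by
      have : 0 ≤ (R + (1 + 2 * v)) / R := div_nonneg (by nlinarith [sq_nonneg (1 + v)]) hR0.le
      rwa [add_div, div_self hR0.ne'] at this
    have hrw (v : ℝ) (hv : v ^ 2 ≤ S) :
        (R + 1 + 2 * v) ^ (-p) = R ^ (-p) * (1 + (1 + 2 * v) / R) ^ (-p) := by
      rw [← Real.mul_rpow hR0.le (hpos v hv)]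
      congr 1
      field_simp
      ring
    have hv1 := hle i
    have hv2 : (-(x i : ℝ)) ^ 2 ≤ S := by rw [neg_sq]; exact hv1
    have e1 : pot A p (x + Pi.single i 1) = (R + 1 + 2 * (x i : ℝ)) ^ (-p) := by
      rw [pot, sum_sq_add_single, ← hS, hR]
      congr 1
      ring
    have e2 : pot A p (x - Pi.single i 1) = (R + 1 + 2 * (-(x i : ℝ))) ^ (-p) := by
      rw [pot, sum_sq_sub_single, ← hS, hR]
      congr 1
      ring
    rw [e1, e2, hrw _ hv1, hrw _ hv2, ← mul_add]
    refine mul_le_mul_of_nonneg_left ?_ (Real.rpow_nonneg hR0.le _)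
    have t1 := hT _ (hu _ hv1)
    have t2 := hT _ (hu _ hv2)
    have hcub : 0 ≤ p * (p + 1) * (p + 2) / 6 * ((2 + 24 * (x i : ℝ) ^ 2) / R ^ 3) := by positivity
    refine (add_le_add t1 t2).trans (le_of_add_le_of_nonneg_left (le_of_eq ?_) hcub)
    field_simp
    ring
  refine (Finset.sum_le_sum fun i _ => hterm i).trans ?_
  have hpot : pot A p x = R ^ (-p) := by rw [pot, ← hS, ← hR]
  rw [hpot, ← Finset.mul_sum, mul_comm]
  refine mul_le_mul_of_nonneg_right ?_ (Real.rpow_nonneg hR0.le _)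
  obtain ⟨F, hF⟩ : ∃ F, F = ∑ i, (x i : ℝ) ^ 4 := ⟨_, rfl⟩
  have hFS : F ≤ S ^ 2 := by
    rw [hF, sq S]
    nth_rewrite 1 [hS]
    rw [Finset.sum_mul]
    refine Finset.sum_le_sum fun i _ => ?_
    nlinarith [hle i, sq_nonneg (x i : ℝ)]
  have hsum : ∑ i, (2 - 2 * p / R + p * (p + 1) * (1 + 4 * (x i : ℝ) ^ 2) / R ^ 2 +
        C * (2 + 48 * (x i : ℝ) ^ 2 + 32 * (x i : ℝ) ^ 4) / R ^ 4) =
      d * (2 - 2 * p / R) + p * (p + 1) * (d + 4 * S) / R ^ 2 +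
        C * (2 * d + 48 * S + 32 * F) / R ^ 4 := by
    simp only [Finset.sum_add_distrib, ← Finset.sum_div, ← Finset.mul_sum, ← hS, ← hF,
      Finset.sum_const, Finset.card_univ, Fintype.card_fin, nsmul_eq_mul]
    ring
  rw [hsum]
  have h4 : C * (2 * d + 48 * S + 32 * F) / R ^ 4 ≤ C * (2 * d + 80) / R ^ 2 := by
    rw [div_le_div_iff₀ (by positivity) (by positivity)]
    have hSR : S ≤ R := by linarith
    have h5 : 2 * d + 48 * S + 32 * F ≤ (2 * d + 80) * R ^ 2 := by
      have hR2 : 1 ≤ R ^ 2 := one_le_pow₀ hR1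
      nlinarith
    calc C * (2 * d + 48 * S + 32 * F) * R ^ 2 ≤ C * ((2 * d + 80) * R ^ 2) * R ^ 2 := by gcongr
      _ = _ := by ring
  have h6 : d * (2 - 2 * p / R) + p * (p + 1) * (d + 4 * S) / R ^ 2 + C * (2 * d + 80) / R ^ 2 =
      2 * d + (p * (p + 1) * d + C * (2 * d + 80) - 4 * A * (p * (p + 1))) / R ^ 2 := by
    have hS' : S = R - A := by linarith
    have hdp : (d : ℝ) = 2 * p + 2 := by rw [hp]; ring
    rw [hS', hdp]
    field_simp
    ring
  have h7 : (p * (p + 1) * d + C * (2 * d + 80) - 4 * A * (p * (p + 1))) / R ^ 2 ≤ 0 :=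
    div_nonpos_of_nonpos_of_nonneg (by linarith) (by positivity)
  linarith

lemma avg_ofReal (hd : d ≠ 0) {g : Zd d → ℝ} (hg : ∀ x, 0 ≤ g x) (x : Zd d) :
    avg (fun y => ENNReal.ofReal (g y)) x = ENNReal.ofReal
      ((2 * d : ℝ)⁻¹ * ∑ i, (g (x + Pi.single i 1) + g (x - Pi.single i 1))) := by
  have h2d : (0 : ℝ) < 2 * d := by
    have := Nat.pos_of_ne_zero hd
    positivity
  rw [ENNReal.ofReal_mul (by positivity), ENNReal.ofReal_inv_of_pos h2d,
    ENNReal.ofReal_sum_of_nonneg fun i _ => add_nonneg (hg _) (hg _)]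
  simp only [ENNReal.ofReal_add (hg _) (hg _), avg]
  congr 2
  rw [ENNReal.ofReal_mul (by norm_num)]
  simp

lemma pot_nonneg {A : ℝ} (hA : 0 ≤ A) (p : ℝ) (x : Zd d) : 0 ≤ pot A p x :=
  Real.rpow_nonneg (add_nonneg (Finset.sum_nonneg fun _ _ => sq_nonneg _) hA) _

lemma avg_ofReal_le {g : Zd d → ℝ} (hd : d ≠ 0) (hg : ∀ x, 0 ≤ g x) {x : Zd d}
    (h : ∑ i, (g (x + Pi.single i 1) + g (x - Pi.single i 1)) ≤ 2 * d * g x) :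
    avg (fun y => ENNReal.ofReal (g y)) x ≤ ENNReal.ofReal (g x) := by
  have h2d : (0 : ℝ) < 2 * d := by
    have := Nat.pos_of_ne_zero hd
    positivity
  rw [avg_ofReal hd hg]
  apply ENNReal.ofReal_le_ofReal
  rwa [inv_mul_le_iff₀ h2d]

/-- A multiple of `pot` dominates the Green function with pole at the origin. -/
lemma exists_potential (hd : 3 ≤ d) : ∃ A C : ℝ, 1 ≤ A ∧ 0 < C ∧
    (∀ x : Zd d, avg (fun y => ENNReal.ofReal (pot A (((d : ℝ) - 2) / 2) y)) x ≤
      ENNReal.ofReal (pot A (((d : ℝ) - 2) / 2) x)) ∧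
    1 + avg (fun y : Zd d => ENNReal.ofReal (C * pot A (((d : ℝ) - 2) / 2) y)) 0 ≤
      ENNReal.ofReal (C * pot A (((d : ℝ) - 2) / 2) (0 : Zd d)) := by
  obtain ⟨A, hA, hsup⟩ := exists_superharmonic hd
  have hd' : (3 : ℝ) ≤ d := by exact_mod_cast hd
  have hA0 : 0 ≤ A := by linarith
  obtain ⟨p, hp⟩ : ∃ p : ℝ, p = ((d : ℝ) - 2) / 2 := ⟨_, rfl⟩
  rw [← hp] at hsup ⊢
  have hp0 : 0 < p := by rw [hp]; linarith
  have hlt : (1 + A) ^ (-p) < A ^ (-p) :=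
    Real.rpow_lt_rpow_of_neg (by linarith) (by linarith) (by linarith)
  have hgap : 0 < A ^ (-p) - (1 + A) ^ (-p) := by linarith
  refine ⟨A, (A ^ (-p) - (1 + A) ^ (-p))⁻¹, hA, by positivity,
    fun x => avg_ofReal_le (by omega) (pot_nonneg hA0 p) (hsup x), ?_⟩
  have h1 (i : Fin d) : pot A p (0 + Pi.single i 1) = (1 + A) ^ (-p) := by
    rw [pot, sum_sq_add_single]
    simp
  have h2 (i : Fin d) : pot A p (0 - Pi.single i 1) = (1 + A) ^ (-p) := by
    rw [pot, sum_sq_sub_single]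
    simp
  have h3 : pot A p (0 : Zd d) = A ^ (-p) := by simp [pot]
  have h4 : (2 * d : ℝ)⁻¹ * ∑ i : Fin d, ((A ^ (-p) - (1 + A) ^ (-p))⁻¹ * (1 + A) ^ (-p) +
      (A ^ (-p) - (1 + A) ^ (-p))⁻¹ * (1 + A) ^ (-p)) =
      (A ^ (-p) - (1 + A) ^ (-p))⁻¹ * (1 + A) ^ (-p) := by
    simp only [Finset.sum_const, Finset.card_univ, Fintype.card_fin, nsmul_eq_mul]
    field_simp
    ring
  rw [avg_ofReal (by omega) fun x => mul_nonneg (by positivity) (pot_nonneg hA0 p x)]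
  simp only [h1, h2, h3, h4]
  rw [← ENNReal.ofReal_one, ← ENNReal.ofReal_add zero_le_one (by positivity)]
  apply ENNReal.ofReal_le_ofReal
  have h5 := inv_mul_cancel₀ hgap.ne'
  linarith

lemma pot_le {A p r : ℝ} (hA : 0 ≤ A) (hp : 0 ≤ p) (hr : 0 < r) {x : Zd d} {j : Fin d}
    (hj : r ≤ |(x j : ℝ)|) : pot A p x ≤ (r ^ 2) ^ (-p) := by
  refine Real.rpow_le_rpow_of_nonpos (by positivity) ?_ (by linarith)
  have h1 : r ^ 2 ≤ (x j : ℝ) ^ 2 := by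
    rw [← sq_abs (x j : ℝ)]
    gcongr
  have h2 := Finset.single_le_sum (f := fun i => (x i : ℝ) ^ 2) (fun i _ => sq_nonneg _)
    (Finset.mem_univ j)
  linarith

lemma le_pot {A p N : ℝ} (hA : 1 ≤ A) (hp : 0 ≤ p) (hN : 1 ≤ N) {x : Zd d}
    (hx : ∀ j, |(x j : ℝ)| ≤ 3 * N) : ((9 * d + A) * N ^ 2) ^ (-p) ≤ pot A p x := by
  have h0 : 0 ≤ ∑ j, (x j : ℝ) ^ 2 := Finset.sum_nonneg fun _ _ => sq_nonneg _
  refine Real.rpow_le_rpow_of_nonpos (by linarith) ?_ (by linarith)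
  have h1 : ∑ j, (x j : ℝ) ^ 2 ≤ ∑ j : Fin d, 9 * N ^ 2 := by
    refine Finset.sum_le_sum fun j _ => ?_
    rw [← sq_abs (x j : ℝ)]
    nlinarith [hx j, abs_nonneg (x j : ℝ)]
  simp only [Finset.sum_const, Finset.card_univ, Fintype.card_fin, nsmul_eq_mul] at h1
  nlinarith [one_le_pow₀ hN (n := 2)]

lemma escape_ge_half (hd : 3 ≤ d) {P : Zd d → Measure (ℕ → Zd d)} (hP : IsSRW d P) {A : ℝ}
    (hA : 1 ≤ A)
    (hsup : ∀ x : Zd d, avg (fun y => ENNReal.ofReal (pot A (((d : ℝ) - 2) / 2) y)) x ≤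
      ENNReal.ofReal (pot A (((d : ℝ) - 2) / 2) x))
    {N : ℕ} (hN : 1 ≤ N) {L : ℝ} (hL : 0 < L) (hNL : 25600 * (9 * d + A) * N ^ 2 ≤ L ^ 2)
    (c₁ c₂ : Zd d) {x : Zd d}
    (hx₁ : ∃ j, L / 40 ≤ |(x j : ℝ) - c₁ j|) (hx₂ : ∃ j, L / 40 ≤ |(x j : ℝ) - c₂ j|) :
    1 / 2 ≤ escape P ({x | ∀ j, |x j - c₁ j| ≤ 3 * (N : ℤ)} ∪
      {x | ∀ j, |x j - c₂ j| ≤ 3 * (N : ℤ)}) x := by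
  obtain ⟨p, hp⟩ : ∃ p : ℝ, p = ((d : ℝ) - 2) / 2 := ⟨_, rfl⟩
  rw [← hp] at hsup
  have hd' : (3 : ℝ) ≤ d := by exact_mod_cast hd
  have hp0 : 1 / 2 ≤ p := by rw [hp]; linarith
  have hA0 : 0 ≤ A := by linarith
  have hN' : (1 : ℝ) ≤ N := by exact_mod_cast hN
  obtain ⟨b, hb⟩ : ∃ b : ℝ, b = (9 * d + A) * N ^ 2 := ⟨_, rfl⟩
  have hb0 : 0 < b := by rw [hb]; positivity
  have hfar {c : Zd d} (hc : ∃ j, L / 40 ≤ |(x j : ℝ) - c j|) :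
      pot A p (x - c) ≤ 1 / 4 * b ^ (-p) := by
    obtain ⟨j, hj⟩ := hc
    refine (pot_le hA0 (by linarith) (r := L / 40) (by positivity) (j := j)
      (by push_cast [Pi.sub_apply]; exact hj)).trans ?_
    have hbL : 16 * b ≤ (L / 40) ^ 2 := by rw [hb]; linarith
    calc ((L / 40) ^ 2) ^ (-p) ≤ (16 * b) ^ (-p) :=
          Real.rpow_le_rpow_of_nonpos (by positivity) hbL (by linarith)
      _ = (16 : ℝ) ^ (-p) * b ^ (-p) := Real.mul_rpow (by norm_num) hb0.le
      _ ≤ (16 : ℝ) ^ (-(1 / 2) : ℝ) * b ^ (-p) := by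
          gcongr
          · norm_num
      _ = 1 / 4 * b ^ (-p) := by
          congr 1
          rw [show (16 : ℝ) = 4 ^ (2 : ℝ) by norm_num, ← Real.rpow_mul (by norm_num)]
          norm_num [Real.rpow_neg_one]
  have hbp : 0 < b ^ (-p) := Real.rpow_pos_of_pos hb0 _
  let G : Zd d → ℝ≥0∞ := fun y => ENNReal.ofReal (pot A p y)
  let K : ℝ≥0∞ := ENNReal.ofReal ((b ^ (-p))⁻¹)
  have hKb : K * ENNReal.ofReal (b ^ (-p)) = 1 := by
    rw [← ENNReal.ofReal_mul (by positivity), inv_mul_cancel₀ hbp.ne', ENNReal.ofReal_one]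
  have hnear {y c : Zd d} (hy : ∀ j, |y j - c j| ≤ 3 * (N : ℤ)) :
      ENNReal.ofReal (b ^ (-p)) ≤ G (y - c) := by
    refine ENNReal.ofReal_le_ofReal ?_
    rw [hb]
    refine le_pot hA (by linarith) hN' fun j => ?_
    have := hy j
    rw [Pi.sub_apply]
    exact_mod_cast this
  have key := one_le_escape_add (by omega) hP (s := fun y => K * (G (y - c₁) + G (y - c₂)))
    (V := {x | ∀ j, |x j - c₁ j| ≤ 3 * (N : ℤ)} ∪ {x | ∀ j, |x j - c₂ j| ≤ 3 * (N : ℤ)})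
    (fun y _ => by
      rw [avg_const_mul, avg_add, avg_sub_right, avg_sub_right]
      gcongr <;> exact hsup _)
    (fun y hy => by
      rw [← hKb]
      gcongr
      rcases hy with hy | hy
      · exact (hnear hy).trans le_self_add
      · exact (hnear hy).trans le_add_self) x
  have hs : K * (G (x - c₁) + G (x - c₂)) ≤ 1 / 2 := by
    have h1 : G (x - c₁) + G (x - c₂) ≤ ENNReal.ofReal (1 / 2 * b ^ (-p)) := by
      rw [← ENNReal.ofReal_add (pot_nonneg hA0 _ _) (pot_nonneg hA0 _ _)]
      refine ENNReal.ofReal_le_ofReal ?_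
      linarith [hfar hx₁, hfar hx₂]
    calc K * (G (x - c₁) + G (x - c₂)) ≤ K * ENNReal.ofReal (1 / 2 * b ^ (-p)) := by gcongr
      _ = ENNReal.ofReal (1 / 2) * (K * ENNReal.ofReal (b ^ (-p))) := by
          rw [ENNReal.ofReal_mul (by norm_num)]
          ring
      _ = 1 / 2 := by
          rw [hKb, mul_one, ENNReal.ofReal_div_of_pos (by norm_num)]
          simp
  have h2 : (1 : ℝ≥0∞) - 1 / 2 = 1 / 2 := by
    rw [one_div, ENNReal.one_sub_inv_two]
  rw [← h2]
  exact tsub_le_iff_right.2 (key.trans (by gcongr))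

lemma abs_sub_le_one_of_adj {x y : Zd d} (h : adj x y) (j : Fin d) : |x j - y j| ≤ 1 := by
  rw [adj] at h
  rw [← h]
  exact Finset.single_le_sum (f := fun i => |x i - y i|) (fun i _ => abs_nonneg _)
    (Finset.mem_univ j)

lemma exists_far_of_mem_bdry {L : ℕ} {V : Set (Zd d)} {z : Zd d}
    (hz : z ∈ bdry (nbhdU d L V) ∪ intBdry (nbhdU d L V)) {v : Zd d} (hv : v ∈ V) :
    ∃ j, (L : ℤ) - 10 < 10 * |z j - v j| := by
  have hout {w : Zd d} (hw : w ∉ nbhdU d L V) : ∃ j, (L : ℤ) < 10 * |w j - v j| := by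
    by_contra! h
    exact hw ⟨v, hv, h⟩
  rcases hz with ⟨hz, -⟩ | ⟨-, w, hw, hzw⟩
  · obtain ⟨j, hj⟩ := hout hz
    exact ⟨j, by omega⟩
  · obtain ⟨j, hj⟩ := hout hw
    refine ⟨j, ?_⟩
    have h1 := abs_sub_le_one_of_adj hzw j
    have h2 := abs_sub_le (w j) (z j) (v j)
    rw [abs_sub_comm (w j) (z j)] at h2
    omega

/-- The entrance estimate for a set from which distant walks escape with probability at
least `1 / 2`. -/
lemma measure_entrance_le_mul_eqm (hd : 3 ≤ d) {P : Zd d → Measure (ℕ → Zd d)}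
    (hP : IsSRW d P) {A C : ℝ} (hA : 1 ≤ A) (hC : 0 < C)
    (hsup : ∀ x : Zd d, avg (fun y => ENNReal.ofReal (pot A (((d : ℝ) - 2) / 2) y)) x ≤
      ENNReal.ofReal (pot A (((d : ℝ) - 2) / 2) x))
    (hpole : 1 + avg (fun y : Zd d => ENNReal.ofReal (C * pot A (((d : ℝ) - 2) / 2) y)) 0 ≤
      ENNReal.ofReal (C * pot A (((d : ℝ) - 2) / 2) (0 : Zd d)))
    {L : ℕ} (hL : 80 ≤ L) {V : Set (Zd d)}
    (hesc : ∀ x, (∀ v ∈ V, ∃ j, (L : ℤ) ≤ 40 * |x j - v j|) → 1 / 2 ≤ escape P V x)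
    {y z : Zd d} (hy : y ∈ V) (hz : ∀ v ∈ V, ∃ j, (L : ℤ) - 10 < 10 * |z j - v j|) :
    (P z {ω | ∃ m : ℕ, ω m = y ∧ ∀ k < m, ω k ∉ V}).toReal ≤
      2 * C * (((L : ℝ) / 80) ^ 2) ^ (-(((d : ℝ) - 2) / 2)) * eqm P V y := by
  classical
  obtain ⟨p, hp⟩ : ∃ p : ℝ, p = ((d : ℝ) - 2) / 2 := ⟨_, rfl⟩
  rw [← hp] at hsup hpole ⊢
  have hd' : (3 : ℝ) ≤ d := by exact_mod_cast hd
  have hp0 : 0 ≤ p := by rw [hp]; linarith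
  have hA0 : 0 ≤ A := by linarith
  have hd0 : d ≠ 0 := by omega
  have hL0 : (0 : ℝ) < L := by
    have : 0 < L := by omega
    exact_mod_cast this
  obtain ⟨κ, hκ⟩ : ∃ κ : ℝ, κ = (((L : ℝ) / 80) ^ 2) ^ (-p) := ⟨_, rfl⟩
  have hκ0 : 0 ≤ κ := hκ ▸ Real.rpow_nonneg (by positivity) _
  rw [← hκ]
  let G : Zd d → ℝ≥0∞ := fun x => ENNReal.ofReal (C * pot A p (x - z))
  have hG (x : Zd d) : avg G x ≤ G x := by
    have h1 : G = fun x => ENNReal.ofReal C * ENNReal.ofReal (pot A p (x - z)) := by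
      ext x
      exact ENNReal.ofReal_mul hC.le
    rw [h1, avg_const_mul, avg_sub_right (fun x => ENNReal.ofReal (pot A p x))]
    exact mul_le_mul' le_rfl (hsup (x - z))
  have hGz : 1 + avg G z ≤ G z := by
    have h1 := avg_sub_right (fun x => ENNReal.ofReal (C * pot A p x)) z z
    rw [sub_self] at h1
    simp only [G]
    rw [h1, sub_self]
    exact hpole
  let K : ℝ≥0∞ := ENNReal.ofReal (2 * C * κ)
  let B : Set (Zd d) := {x | ∀ j, 40 * |x j - z j| < (L : ℤ)}
  let s : Zd d → ℝ≥0∞ := fun x => if x ∈ B then G x else min (K * escape P V x) (G x)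
  have hzV : z ∉ V := by
    intro h
    obtain ⟨j, hj⟩ := hz z h
    rw [sub_self, abs_zero] at hj
    omega
  have hzB : z ∈ B := by
    intro j
    rw [sub_self, abs_zero]
    omega
  have hsG (x : Zd d) : s x ≤ G x := by
    simp only [s]
    split_ifs
    · exact le_rfl
    · exact min_le_right _ _
  have hsK {x x' : Zd d} (hx : x ∉ B) (hxx' : adj x x') : s x' ≤ K * escape P V x' := by
    simp only [s]
    split_ifs with hx'
    · have hhalf : 1 / 2 ≤ escape P V x' := by
        refine hesc x' fun v hv => ?_
        obtain ⟨j, hj⟩ := hz v hv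
        refine ⟨j, ?_⟩
        have h1 := hx' j
        have h2 := abs_sub_le (z j) (x' j) (v j)
        rw [abs_sub_comm (z j) (x' j)] at h2
        omega
      have hfar : ∃ j, (L : ℤ) ≤ 80 * |x' j - z j| := by
        obtain ⟨j, hj⟩ : ∃ j, (L : ℤ) ≤ 40 * |x j - z j| := by
          by_contra! h
          exact hx h
        refine ⟨j, ?_⟩
        have h1 := abs_sub_le_one_of_adj hxx' j
        have h2 := abs_sub_le (x j) (x' j) (z j)
        omega
      obtain ⟨j, hj⟩ := hfar
      have hjR : (L : ℝ) ≤ 80 * |(x' j : ℝ) - z j| := by exact_mod_cast hj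
      calc G x' ≤ ENNReal.ofReal (C * κ) := by
            refine ENNReal.ofReal_le_ofReal ?_
            gcongr
            rw [hκ]
            refine pot_le hA0 hp0 (by positivity) (j := j) ?_
            push_cast [Pi.sub_apply]
            linarith
        _ = K * (1 / 2) := by
            simp only [K]
            rw [show 2 * C * κ = C * κ * 2 by ring, ENNReal.ofReal_mul (q := 2) (by positivity),
              mul_assoc (ENNReal.ofReal _), ENNReal.ofReal_ofNat, one_div,
              ENNReal.mul_inv_cancel (by norm_num) (by norm_num), mul_one]
        _ ≤ K * escape P V x' := by gcongr
    · exact min_le_left _ _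
  have hyB (x : Zd d) (h : adj y x) : x ∉ B := by
    intro hx
    obtain ⟨j, hj⟩ := hz y hy
    have h1 := hx j
    have h2 := abs_sub_le_one_of_adj h j
    have h3 := abs_sub_le (z j) (x j) (y j)
    rw [abs_sub_comm (z j) (x j), abs_sub_comm (x j) (y j)] at h3
    omega
  have hmain := measure_entrance_le hd0 hP hy hzV (s := s)
    (fun x hx => by
      have h1 : avg s x ≤ G x := (avg_mono fun x' _ => hsG x').trans (hG x)
      by_cases hxB : x ∈ B
      · simpa only [s, if_pos hxB] using h1
      · have h2 : avg s x ≤ K * escape P V x := by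
          rw [escape_eq_avg hd0 hP hx, ← avg_const_mul]
          exact avg_mono fun x' hx' => hsK hxB hx'
        simpa only [s, if_neg hxB] using le_min h2 h1)
    (by
      have h1 : s z = G z := if_pos hzB
      rw [h1]
      exact (add_le_add le_rfl (avg_mono fun x _ => hsG x)).trans hGz)
  have hyK : avg s y ≤ K * avg (escape P V) y := by
    rw [← avg_const_mul]
    refine avg_mono fun x hx => ?_
    simp only [s, if_neg (hyB x hx)]
    exact min_le_left _ _
  have hfin : avg (escape P V) y ≠ ∞ := by
    refine ne_top_of_le_ne_top ENNReal.one_ne_top ?_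
    rw [← avg_const hd0 1 y]
    exact avg_mono fun x _ => by
      have := hP.1 x
      exact prob_le_one
  have h := ENNReal.toReal_mono (ENNReal.mul_ne_top ENNReal.ofReal_ne_top hfin) (hmain.trans hyK)
  rwa [ENNReal.toReal_mul, ENNReal.toReal_ofReal (by positivity), ← eqm_eq_avg hd0 hP hy] at h

lemma one_le_ellOf (L : ℕ) : 1 ≤ ellOf L := Nat.le_add_left _ _

lemma le_Lseq (L0 n : ℕ) : L0 ≤ Lseq L0 n := by
  induction n with
  | zero => exact le_rfl
  | succ n ih => exact ih.trans (Nat.le_mul_of_pos_left _ (one_le_ellOf _))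

lemma le_ellOf {M L : ℕ} (h : M ^ 100 ≤ L) : M ≤ ellOf L := by
  have h1 : (M : ℝ) ≤ (L : ℝ) ^ ((1 : ℝ) / 100) := by
    have h2 : (M : ℝ) ^ (100 : ℕ) ≤ L := by exact_mod_cast h
    calc (M : ℝ) = ((M : ℝ) ^ (100 : ℕ)) ^ ((1 : ℝ) / 100) := by
          rw [← Real.rpow_natCast, ← Real.rpow_mul (by positivity)]
          norm_num
      _ ≤ _ := by gcongr
  have h3 := Nat.le_floor h1
  unfold ellOf
  omega

end RI

/-- **Entrance-point estimate** (Lemma 2.2).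
With `V` the union of two boxes of side `6 L_n` centred at `2 L_n i₁` and `2 L_n i₂`
(`|i₁|_∞ = (ℓ_n - 1)/2`, `|i₂|_∞ = ℓ_n`), and `U` its `ℓ^∞`-neighbourhood of size
`L_{n+1}/10`, one has `P_z[H_V < ∞, X_{H_V} = y] ≤ c L_{n+1}^{-(d-2)} e_V(y)`
for all `y ∈ V` and `z ∈ ∂U ∪ ∂_int U`, provided `L₀ ≥ c'`. -/
theorem entrance_point_estimate (d : ℕ) (hd : 3 ≤ d) :
    ∃ c c' : ℝ, 0 < c ∧ 0 < c' ∧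
      ∀ L0 : ℕ, c' ≤ (L0 : ℝ) → ∀ n : ℕ, ∀ i1 i2 : ℤ × ℤ,
        max |i1.1| |i1.2| = ((ellOf (Lseq L0 n) : ℤ) - 1) / 2 →
        max |i2.1| |i2.2| = (ellOf (Lseq L0 n) : ℤ) →
        ∀ (P : Zd d → Measure (ℕ → Zd d)), IsSRW d P →
          ∀ y ∈ twoBoxV d (Lseq L0 n) i1 i2,
            ∀ z ∈ bdry (nbhdU d (Lseq L0 (n + 1)) (twoBoxV d (Lseq L0 n) i1 i2)) ∪
                intBdry (nbhdU d (Lseq L0 (n + 1)) (twoBoxV d (Lseq L0 n) i1 i2)),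
              (P z {ω | ∃ m : ℕ, ω m = y ∧
                  ∀ k < m, ω k ∉ twoBoxV d (Lseq L0 n) i1 i2}).toReal ≤
                c * (Lseq L0 (n + 1) : ℝ) ^ (-((d : ℝ) - 2)) *
                  eqm P (twoBoxV d (Lseq L0 n) i1 i2) y := by
  obtain ⟨A, C, hA, hC, hsup, hpole⟩ := exists_potential hd
  have hd' : (3 : ℝ) ≤ d := by exact_mod_cast hd
  obtain ⟨M, hM⟩ := exists_nat_ge (80 + 25600 * (9 * d + A))
  have hM1 : (1 : ℝ) ≤ M := by nlinarith
  have hM80 : 80 ≤ M := by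
    have : (80 : ℝ) ≤ M := by nlinarith
    exact_mod_cast this
  refine ⟨2 * C * (80 : ℝ) ^ ((d : ℝ) - 2), (M : ℝ) ^ 100, by positivity, by positivity, ?_⟩
  intro L0 hL0 n i1 i2 _ _ P hP y hy z hz
  have hL0' : M ^ 100 ≤ L0 := by exact_mod_cast hL0
  have hMn : M ^ 100 ≤ Lseq L0 n := hL0'.trans (le_Lseq L0 n)
  have hell : M ≤ ellOf (Lseq L0 n) := le_ellOf hMn
  have hN : 1 ≤ Lseq L0 n := (Nat.one_le_pow _ _ (by omega)).trans hMn
  have hLeq : Lseq L0 (n + 1) = ellOf (Lseq L0 n) * Lseq L0 n := rfl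
  generalize Lseq L0 (n + 1) = L at *
  generalize Lseq L0 n = N at *
  have hML : M * N ≤ L := hLeq ▸ Nat.mul_le_mul_right N hell
  have hL80 : 80 ≤ L := le_trans (by nlinarith) hML
  have hL0 : (0 : ℝ) < L := by
    have : 0 < L := by omega
    exact_mod_cast this
  have hNL : 25600 * (9 * d + A) * (N : ℝ) ^ 2 ≤ (L : ℝ) ^ 2 := by
    have h1 : (M : ℝ) * N ≤ L := by exact_mod_cast hML
    have h2 : 25600 * (9 * d + A) ≤ (M : ℝ) ^ 2 := by nlinarith
    calc 25600 * (9 * d + A) * (N : ℝ) ^ 2 ≤ (M : ℝ) ^ 2 * (N : ℝ) ^ 2 := by gcongr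
      _ = (M * N : ℝ) ^ 2 := by ring
      _ ≤ (L : ℝ) ^ 2 := by gcongr
  have hesc (x : Zd d) (hx : ∀ v ∈ twoBoxV d N i1 i2, ∃ j, (L : ℤ) ≤ 40 * |x j - v j|) :
      1 / 2 ≤ escape P (twoBoxV d N i1 i2) x := by
    have hc {c : Zd d} (hc : c ∈ twoBoxV d N i1 i2) : ∃ j, (L : ℝ) / 40 ≤ |(x j : ℝ) - c j| := by
      obtain ⟨j, hj⟩ := hx c hc
      have : (L : ℝ) ≤ 40 * |(x j : ℝ) - c j| := by exact_mod_cast hj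
      exact ⟨j, by linarith⟩
    exact escape_ge_half hd hP hA hsup hN hL0 hNL (fun j => 2 * (N : ℤ) * embPlane d i1 j)
      (fun j => 2 * (N : ℤ) * embPlane d i2 j) (hc (.inl fun j => by simp))
      (hc (.inr fun j => by simp))
  refine (measure_entrance_le_mul_eqm hd hP hA hC hsup hpole hL80 hesc hy
    fun v hv => exists_far_of_mem_bdry hz hv).trans (le_of_eq ?_)
  congr 1
  rw [← Real.rpow_natCast, ← Real.rpow_mul (by positivity),
    Real.div_rpow hL0.le (by norm_num), mul_assoc]
  have he : ((2 : ℕ) : ℝ) * -(((d : ℝ) - 2) / 2) = -((d : ℝ) - 2) := by push_cast; ring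
  rw [he, Real.rpow_neg (by norm_num : (0 : ℝ) ≤ 80), div_inv_eq_mul]
  ring
end

section
/- Let d ≥ 3. There exists a constant c > 0 such that for every integer L_0 ≥ c the following holds. Set L = 1000⌊L_0·exp(−(log L_0)^{1/3})⌋, K = ⌊2L_0/L⌋, K' = ⌊10^4·L_0/L⌋. Let x_0, x_1, …, x_N be any *-path contained in ([0, 2L_0]×[0, 6L_0]×{0}^{d−2}) ∩ ℤ^d with x_0 ∈ {0}×[0, 6L_0]×{0}^{d−2} and x_N ∈ {2L_0 − 1}×[0, 6L_0]×{0}^{d−2}, and let S = {x_0, …, x_N} be its range. Then for each integer 0 ≤ k < K there exists an integer ℓ_k with |ℓ_k| < K' such that |π_1(S ∩ C_{k,ℓ_k})| ≥ L/4 or |π_2(S ∩ C_{k,ℓ_k})| ≥ L/4. -/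
open MeasureTheory Filter

namespace RI

/-- `M = ⌊L₀ exp(-(log L₀)^{1/3})⌋`, so that the smaller scale is `L = 1000 M`. -/
noncomputable def Mof (L0 : ℕ) : ℕ :=
  ⌊(L0 : ℝ) * Real.exp (-(Real.log L0) ^ ((1 : ℝ) / 3))⌋₊

/-- The smaller length scale `L = 1000 ⌊L₀ exp(-(log L₀)^{1/3})⌋`. -/
noncomputable def Lof (L0 : ℕ) : ℕ := 1000 * Mof L0

/-- `K = ⌊2L₀/L⌋`. -/
noncomputable def Kof (L0 : ℕ) : ℕ := 2 * L0 / Lof L0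

/-- `K' = ⌊10⁴ L₀/L⌋`. -/
noncomputable def K'of (L0 : ℕ) : ℕ := 10000 * L0 / Lof L0

/-- The square `C_{k,ℓ} = (kL e₁ + (ℓL/1000) e₂ + [0,L]² × {0}^{d-2}) ∩ ℤ^d`. -/
noncomputable def CklSet (d : ℕ) (L0 : ℕ) (k : ℕ) (l : ℤ) : Set (Zd d) :=
  {x | inPlane x ∧ (k * Lof L0 : ℤ) ≤ coord x 0 ∧ coord x 0 ≤ (k * Lof L0 : ℤ) + (Lof L0 : ℤ) ∧
       l * (Mof L0 : ℤ) ≤ coord x 1 ∧ coord x 1 ≤ l * (Mof L0 : ℤ) + (Lof L0 : ℤ)}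

/-- The vertical segment `I_v = π₁⁻¹(v) ∩ C_{k,ℓ}`. -/
noncomputable def segSet (d : ℕ) (L0 : ℕ) (k : ℕ) (l : ℤ) (v : ℤ) : Set (Zd d) :=
  {x | x ∈ CklSet d L0 k l ∧ coord x 0 = v}

end RI

namespace RI

lemma abs_coord_sub_le_one {d : ℕ} {x y : Zd d} (h : starAdj x y) (i : ℕ) :
    |coord y i - coord x i| ≤ 1 := by
  unfold coord
  split_ifs with hi
  · rw [abs_sub_comm]
    exact h.2 ⟨i, hi⟩
  · simp

/-- Discrete intermediate value theorem for integer sequences with increments at most `1`. -/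
lemma exists_eq_of_le_of_le {f : ℕ → ℤ} {a b : ℕ} {v : ℤ} (hab : a ≤ b)
    (hf : ∀ n, a ≤ n → n < b → |f (n + 1) - f n| ≤ 1) (ha : f a ≤ v) (hb : v ≤ f b) :
    ∃ m, a ≤ m ∧ m ≤ b ∧ f m = v := by
  induction b, hab using Nat.le_induction with
  | base => exact ⟨a, le_rfl, le_rfl, le_antisymm ha hb⟩
  | succ b hab ih =>
    by_cases h : v ≤ f b
    · obtain ⟨m, h1, h2, h3⟩ := ih (fun n h1 h2 => hf n h1 (by omega)) h
      exact ⟨m, h1, by omega, h3⟩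
    · have := abs_le.1 (hf b hab (by omega))
      exact ⟨b + 1, by omega, le_rfl, by omega⟩

lemma uIcc_subset_image_Icc {f : ℕ → ℤ} {a b : ℕ} (hab : a ≤ b)
    (hf : ∀ n, a ≤ n → n < b → |f (n + 1) - f n| ≤ 1) :
    Set.uIcc (f a) (f b) ⊆ f '' Set.Icc a b := by
  intro v hv
  rcases Set.mem_uIcc.1 hv with ⟨h1, h2⟩ | ⟨h1, h2⟩
  · obtain ⟨m, h3, h4, h5⟩ := exists_eq_of_le_of_le hab hf h1 h2
    exact ⟨m, ⟨h3, h4⟩, h5⟩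
  · obtain ⟨m, h3, h4, h5⟩ := exists_eq_of_le_of_le (f := fun n => -f n) (v := -v) hab
      (fun n h3 h4 => by
        rw [show -f (n + 1) - -f n = -(f (n + 1) - f n) by ring, abs_neg]
        exact hf n h3 h4) (by omega) (by omega)
    exact ⟨m, ⟨h3, h4⟩, by omega⟩

/-- A sequence with increments at most `1` that goes from below `A` to above `B` has a crossing
of `[A, B]` that stays inside `[A, B]`. -/
lemma exists_crossing {f : ℕ → ℤ} {a b : ℕ} {A B : ℤ} (hab : a ≤ b) (hAB : A ≤ B)
    (hf : ∀ n, a ≤ n → n < b → |f (n + 1) - f n| ≤ 1) (ha : f a ≤ A) (hb : B ≤ f b) :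
    ∃ a' b', a' ≤ b' ∧ b' ≤ b ∧ f a' = A ∧ f b' = B ∧
      ∀ n, a' ≤ n → n ≤ b' → A ≤ f n ∧ f n ≤ B := by
  induction hk : b - a using Nat.strong_induction_on generalizing a b with
  | _ k ih =>
  subst hk
  by_cases h : ∃ n, a ≤ n ∧ n ≤ b ∧ (f n ≤ A ∧ n ≠ a ∨ B ≤ f n ∧ n ≠ b)
  · obtain ⟨n, h1, h2, ⟨h3, h4⟩ | ⟨h3, h4⟩⟩ := h
    · exact ih (b - n) (by omega) h2 (fun m h5 h6 => hf m (by omega) h6) h3 hb rfl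
    · obtain ⟨a', b', h5, h6, h7⟩ :=
        ih (n - a) (by omega) h1 (fun m h5 h6 => hf m h5 (by omega)) ha h3 rfl
      exact ⟨a', b', h5, by omega, h7⟩
  · push Not at h
    have hA : f a = A := by
      obtain ⟨m, h1, h2, h3⟩ := exists_eq_of_le_of_le hab hf ha (hAB.trans hb)
      rw [← (h m h1 h2).1 h3.le, h3]
    have hB : f b = B := by
      obtain ⟨m, h1, h2, h3⟩ := exists_eq_of_le_of_le hab hf (ha.trans hAB) hb
      rw [← (h m h1 h2).2 h3.ge, h3]
    refine ⟨a, b, hab, le_rfl, hA, hB, fun n h1 h2 => ⟨?_, ?_⟩⟩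
    · by_contra! h3
      have := (h n h1 h2).1 h3.le
      grind
    · by_contra! h3
      have := (h n h1 h2).2 h3.le
      grind

/-- A sequence with increments at most `1`, started inside the interval `[p, q]`,
either stays in this interval or has an initial piece which stays in it and reaches `p` or `q`. -/
lemma stays_or_reaches {g : ℕ → ℤ} {a b : ℕ} {p q : ℤ}
    (hg : ∀ n, a ≤ n → n < b → |g (n + 1) - g n| ≤ 1) (hp : p ≤ g a) (hq : g a ≤ q) :
    (∀ n, a ≤ n → n ≤ b → p ≤ g n ∧ g n ≤ q) ∨
      ∃ c, a ≤ c ∧ c ≤ b ∧ (∀ n, a ≤ n → n ≤ c → p ≤ g n ∧ g n ≤ q) ∧ (g c = p ∨ g c = q) := by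
  by_contra! h
  obtain ⟨⟨m, h1, h2, h3⟩, h4⟩ := h
  have key : ∀ n, a ≤ n → n ≤ b → p ≤ g n ∧ g n ≤ q := by
    intro n
    induction n using Nat.strong_induction_on with
    | _ n ih =>
    intro h5 h6
    rcases h5.eq_or_lt with rfl | h5
    · exact ⟨hp, hq⟩
    · obtain ⟨n, rfl⟩ : ∃ k, n = k + 1 := ⟨n - 1, by omega⟩
      have h7 := ih n (by omega) (by omega) (by omega)
      have h8 := h4 n (by omega) (by omega) fun k h9 h10 => ih k (by omega) h9 (by omega)
      have h9 := abs_le.1 (hg n (by omega) (by omega))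
      omega
  have := key m h1 h2
  grind

lemma le_ncard_image_of_path {d : ℕ} {S : Set (Zd d)} {x : ℕ → Zd d} {a b i : ℕ} {r : ℝ}
    (hab : a ≤ b) (hS : ∀ n, a ≤ n → n ≤ b → x n ∈ S)
    (hx : ∀ n, a ≤ n → n < b → starAdj (x n) (x (n + 1)))
    (hfin : ((fun x => coord x i) '' S).Finite)
    (hr : r ≤ |coord (x b) i - coord (x a) i| + 1) :
    r ≤ (((fun x => coord x i) '' S).ncard : ℝ) := by
  have hsub : Set.uIcc (coord (x a) i) (coord (x b) i) ⊆ (fun x => coord x i) '' S := by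
    intro v hv
    obtain ⟨m, h1, h2⟩ := uIcc_subset_image_Icc (f := fun n => coord (x n) i) hab
      (fun n h1 h2 => abs_coord_sub_le_one (hx n h1 h2) i) hv
    exact ⟨x m, hS m h1.1 h1.2, h2⟩
  have h := Set.ncard_le_ncard hsub hfin
  rw [← Finset.coe_uIcc, Set.ncard_coe_finset, Int.card_uIcc] at h
  refine hr.trans ?_
  have h' : |coord (x b) i - coord (x a) i| + 1 ≤ (((fun x => coord x i) '' S).ncard : ℤ) := by
    rw [Int.abs_eq_natAbs]
    omega
  exact_mod_cast h'

end RI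

open RI MeasureTheory Filter

/-- **The geometric lemma** (Lemma 3.2).
Any `*`-path in the strip `([0,2L₀] × [0,6L₀] × {0}^{d-2}) ∩ ℤ^d` from
`{0} × [0,6L₀] × {0}^{d-2}` to `{2L₀-1} × [0,6L₀] × {0}^{d-2}` meets, for each `0 ≤ k < K`,
some square `C_{k,ℓ_k}` (with `|ℓ_k| < K'`) in a set whose image under `π₁` or under `π₂`
has at least `L/4` points. -/
theorem geometric_lemma (d : ℕ) (hd : 3 ≤ d) :
    ∃ c : ℝ, 0 < c ∧
      ∀ L0 : ℕ, c ≤ (L0 : ℝ) →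
        ∀ (N : ℕ) (xp : ℕ → Zd d),
          (∀ m ≤ N, inPlane (xp m) ∧ 0 ≤ coord (xp m) 0 ∧ coord (xp m) 0 ≤ (2 * L0 : ℤ) ∧
            0 ≤ coord (xp m) 1 ∧ coord (xp m) 1 ≤ (6 * L0 : ℤ)) →
          coord (xp 0) 0 = 0 →
          coord (xp N) 0 = (2 * L0 : ℤ) - 1 →
          (∀ m < N, starAdj (xp m) (xp (m + 1))) →
          ∀ k : ℕ, k < Kof L0 →
            ∃ l : ℤ, |l| < (K'of L0 : ℤ) ∧
              ((Lof L0 : ℝ) / 4 ≤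
                  (((fun x => coord x 0) '' (xp '' {m | m ≤ N} ∩ CklSet d L0 k l)).ncard : ℝ) ∨
                (Lof L0 : ℝ) / 4 ≤
                  (((fun x => coord x 1) '' (xp '' {m | m ≤ N} ∩ CklSet d L0 k l)).ncard : ℝ)) := by
  refine ⟨1, one_pos, fun L0 _ N xp hbox h0 hN hadj k hk => ?_⟩
  unfold Kof at hk
  have hLM : Lof L0 = 1000 * Mof L0 := rfl
  have hK' : K'of L0 = 10000 * L0 / Lof L0 := rfl
  set L := Lof L0
  set M := Mof L0
  have hL : 0 < L := by
    by_contra! h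
    simp [Nat.le_zero.1 h] at hk
  have hkL : (k + 1) * L ≤ 2 * L0 := (Nat.le_div_iff_mul_le hL).1 hk
  have hkL' : (k : ℤ) * L + L ≤ 2 * L0 := by
    have : ((k + 1 : ℕ) * L : ℤ) ≤ (2 * L0 : ℕ) := by exact_mod_cast hkL
    push_cast at this
    linarith
  have hkL0 : (0 : ℤ) ≤ (k : ℤ) * L := by positivity
  obtain ⟨a, b, hab, hbN, hfa, hfb, hf⟩ :=
    exists_crossing (f := fun n => coord (xp n) 0) (A := k * L) (B := k * L + L - 1)
      (Nat.zero_le N) (by omega) (fun n _ h => abs_coord_sub_le_one (hadj n h) 0)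
      (by simp only [h0, hkL0]) (by simp only [hN]; omega)
  obtain ⟨-, -, -, hya, hya'⟩ := hbox a (hab.trans hbN)
  set y := coord (xp a) 1 with hy
  have hM : (0 : ℤ) < M := by omega
  have hlo := Int.mul_ediv_self_le (x := y) hM.ne'
  have hhi := Int.lt_mul_ediv_self_add (x := y) hM
  have hq0 : 0 ≤ y / M := Int.ediv_nonneg hya hM.le
  set q := y / (M : ℤ)
  refine ⟨q - 500, ?_, ?_⟩
  · have hlt : q.toNat + 501 ≤ K'of L0 := by
      rw [hK', Nat.le_div_iff_mul_le hL, hLM]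
      zify
      rw [Int.toNat_of_nonneg hq0]
      nlinarith
    rw [abs_lt]
    omega
  · have hqM : (q - 500) * (M : ℤ) = M * q - 500 * M := by ring
    have hx : ∀ c ≤ b, ∀ n, a ≤ n → n < c → starAdj (xp n) (xp (n + 1)) :=
      fun c hc n _ h => hadj n (by omega)
    have hfin (i : ℕ) :
        ((fun x => coord x i) '' (xp '' {m | m ≤ N} ∩ CklSet d L0 k (q - 500))).Finite :=
      (((Set.finite_le_nat N).image xp).inter_of_left _).image _
    have hmem : ∀ n, a ≤ n → n ≤ b → (q - 500) * (M : ℤ) ≤ coord (xp n) 1 ∧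
        coord (xp n) 1 ≤ (q - 500) * (M : ℤ) + L →
        xp n ∈ xp '' {m | m ≤ N} ∩ CklSet d L0 k (q - 500) := by
      intro n h1 h2 h3
      have h4 := hf n h1 h2
      exact ⟨⟨n, h2.trans hbN, rfl⟩, (hbox n (h2.trans hbN)).1, h4.1, by
        change _ ≤ (k : ℤ) * L + L
        omega, h3.1, h3.2⟩
    rcases stays_or_reaches (g := fun n => coord (xp n) 1) (a := a) (b := b)
      (p := (q - 500) * (M : ℤ)) (q := (q - 500) * (M : ℤ) + L)
      (fun n h1 h2 => abs_coord_sub_le_one (hx b le_rfl n h1 h2) 1)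
      (by simp only [← hy]; omega) (by simp only [← hy]; omega) with h | ⟨c, hac, hcb, h, hc⟩
    · left
      refine le_ncard_image_of_path hab (fun n h1 h2 => hmem n h1 h2 (h n h1 h2))
        (hx b le_rfl) (hfin 0) ?_
      have : (L : ℤ) ≤ |coord (xp b) 0 - coord (xp a) 0| + 1 := by
        rw [hfa, hfb, ← sub_le_iff_le_add]
        exact le_abs.2 (.inl (by omega))
      have h' : (L : ℝ) ≤ |coord (xp b) 0 - coord (xp a) 0| + 1 := by exact_mod_cast this
      have hL' : (0 : ℝ) ≤ L := Nat.cast_nonneg L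
      push_cast at h' ⊢
      linarith
    · right
      refine le_ncard_image_of_path hac (fun n h1 h2 => hmem n h1 (h2.trans hcb) (h n h1 h2))
        (hx c hcb) (hfin 1) ?_
      have : (L : ℤ) ≤ 4 * (|coord (xp c) 1 - coord (xp a) 1| + 1) := by
        rcases hc with hc | hc
        · have := neg_le_abs (coord (xp c) 1 - coord (xp a) 1)
          omega
        · have := le_abs_self (coord (xp c) 1 - coord (xp a) 1)
          omega
      have h' : (L : ℝ) ≤ 4 * (|coord (xp c) 1 - coord (xp a) 1| + 1) := by exact_mod_cast this
      push_cast at h' ⊢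
      linarith
end

section
/- Let d ≥ 3. There exist constants c_8 > 0 and c > 0 depending only on d such that for every integer L_0 ≥ c and every choice of integers (ℓ_k)_{0≤k<K} with |ℓ_k| < K', one has sup_{x ∈ ℤ^d} E_x[ exp{ (c_8 / log(L_0/L)) · (log L / L) · Σ_{I ∈ 𝒮} 1_{H_I < ∞} } ] ≤ 2. -/
open MeasureTheory Filter

open RI MeasureTheory Filter

/-- A smoothed Newtonian kernel on `ℝ³`. -/
noncomputable def newtonKernel (p q r : ℝ) : ℝ := (√(p ^ 2 + q ^ 2 + r ^ 2 + 8))⁻¹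

theorem inv_sqrt_one_sub_le {w : ℝ} (h0 : 0 ≤ w) (h1 : w ≤ 1 / 4) :
    (√(1 - w))⁻¹ ≤ 1 + w / 2 + w ^ 2 / 2 := by
  have hw : 0 < 1 - w := by linarith
  rw [inv_le_comm₀ (Real.sqrt_pos.2 hw) (by positivity)]
  apply Real.le_sqrt_of_sq_le
  rw [inv_pow, inv_le_comm₀ (by positivity) hw, inv_le_iff_one_le_mul₀ hw]
  have : 0 ≤ w ^ 2 * (1 / 4 - 3 / 4 * w - w ^ 2 / 4 - w ^ 3 / 4) := by
    apply mul_nonneg (by positivity)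
    nlinarith [mul_nonneg h0 h0, mul_nonneg h0 (sub_nonneg.2 h1),
      mul_nonneg (mul_nonneg h0 h0) (sub_nonneg.2 h1)]
  nlinarith

theorem inv_sqrt_add_inv_sqrt_le {u : ℝ} (hu : |u| ≤ 1 / 2) :
    (√(1 + u))⁻¹ + (√(1 - u))⁻¹ ≤ 2 + 3 / 4 * u ^ 2 + u ^ 4 := by
  obtain ⟨h1, h2⟩ := abs_le.1 hu
  have ha : 0 < 1 + u := by linarith
  have hb : 0 < 1 - u := by linarith
  have hw : u ^ 2 ≤ 1 / 4 := by nlinarith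
  have hw' : 0 < 1 - u ^ 2 := by linarith
  have key := inv_sqrt_one_sub_le (sq_nonneg u) hw
  have hab : (√(1 + u))⁻¹ * (√(1 - u))⁻¹ = (√(1 - u ^ 2))⁻¹ := by
    rw [← mul_inv, ← Real.sqrt_mul ha.le]; congr 2; ring
  have hsq : ((√(1 + u))⁻¹) ^ 2 + ((√(1 - u))⁻¹) ^ 2 = 2 / (1 - u ^ 2) := by
    rw [inv_pow, inv_pow, Real.sq_sqrt ha.le, Real.sq_sqrt hb.le]
    have : 1 - u ^ 2 = (1 + u) * (1 - u) := by ring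
    rw [this]; field_simp; ring
  have hinv : 2 / (1 - u ^ 2) ≤ 2 + 2 * u ^ 2 + 8 / 3 * u ^ 4 := by
    rw [div_le_iff₀ hw']
    have : 0 ≤ u ^ 4 * (1 / 4 - u ^ 2) := mul_nonneg (by positivity) (by linarith)
    nlinarith
  apply (pow_le_pow_iff_left₀ (by positivity) (by positivity) two_ne_zero).1
  have h6 : 0 ≤ u ^ 6 := by positivity
  have h8 : 0 ≤ u ^ 8 := by positivity
  have h4 : 0 ≤ u ^ 4 := by positivity
  nlinarith

theorem newtonKernel_neighbour_sum_le (p q r : ℝ) :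
    (newtonKernel (p + 1) q r + newtonKernel (p - 1) q r) +
      (newtonKernel p (q + 1) r + newtonKernel p (q - 1) r) +
      (newtonKernel p q (r + 1) + newtonKernel p q (r - 1)) ≤ 6 * newtonKernel p q r := by
  set t := p ^ 2 + q ^ 2 + r ^ 2 + 9 with ht
  have htpos : 0 < t := by positivity
  have ht9 : 9 ≤ t := by nlinarith [sq_nonneg p, sq_nonneg q, sq_nonneg r]
  have pair : ∀ y : ℝ, y ^ 2 + 9 ≤ t →
      (√(t + 2 * y))⁻¹ + (√(t - 2 * y))⁻¹ ≤
        (√t)⁻¹ * (2 + 3 * y ^ 2 / t ^ 2 + 16 * y ^ 2 / t ^ 3) := by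
    intro y hy
    have hu : |2 * y / t| ≤ 1 / 2 := by
      rw [abs_div, abs_of_pos htpos, div_le_iff₀ htpos, abs_le]
      constructor <;> nlinarith [sq_nonneg (y - 2), sq_nonneg (y + 2)]
    have h := inv_sqrt_add_inv_sqrt_le hu
    have e1 : t + 2 * y = t * (1 + 2 * y / t) := by field_simp
    have e2 : t - 2 * y = t * (1 - 2 * y / t) := by field_simp
    rw [e1, e2, Real.sqrt_mul htpos.le, Real.sqrt_mul htpos.le, mul_inv, mul_inv, ← mul_add]
    refine mul_le_mul_of_nonneg_left (h.trans ?_) (by positivity)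
    have e3 : 3 / 4 * (2 * y / t) ^ 2 = 3 * y ^ 2 / t ^ 2 := by field_simp; ring
    have e4 : (2 * y / t) ^ 4 ≤ 16 * y ^ 2 / t ^ 3 := by
      rw [div_pow, div_le_div_iff₀ (by positivity) (by positivity)]
      have : 0 ≤ 16 * y ^ 2 * t ^ 3 * (t - y ^ 2) :=
        mul_nonneg (by positivity) (by linarith)
      nlinarith
    linarith
  have hs : (√t)⁻¹ * (1 + 1 / (2 * t)) ≤ newtonKernel p q r := by
    unfold newtonKernel
    have hpos : 0 < p ^ 2 + q ^ 2 + r ^ 2 + 8 := by positivity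
    rw [le_inv_comm₀ (by positivity) (Real.sqrt_pos.2 hpos), mul_inv, inv_inv]
    apply Real.sqrt_le_iff.2
    refine ⟨by positivity, ?_⟩
    rw [mul_pow, Real.sq_sqrt htpos.le, inv_pow, ← div_eq_mul_inv, le_div_iff₀ (by positivity)]
    have e : p ^ 2 + q ^ 2 + r ^ 2 + 8 = t - 1 := by rw [ht]; ring
    rw [e]
    have : (t - 1) * (1 + 1 / (2 * t)) ^ 2 = t - (3 / 4) / t - 1 / (4 * t ^ 2) := by
      field_simp; ring
    rw [this]
    have h1 : 0 ≤ 3 / 4 / t := by positivity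
    have h2 : 0 ≤ 1 / (4 * t ^ 2) := by positivity
    linarith
  have hp := pair p (by nlinarith [sq_nonneg q, sq_nonneg r])
  have hq := pair q (by nlinarith [sq_nonneg p, sq_nonneg r])
  have hr := pair r (by nlinarith [sq_nonneg q, sq_nonneg p])
  have e1 : newtonKernel (p + 1) q r = (√(t + 2 * p))⁻¹ := by
    unfold newtonKernel; congr 2; rw [ht]; ring
  have e2 : newtonKernel (p - 1) q r = (√(t - 2 * p))⁻¹ := by
    unfold newtonKernel; congr 2; rw [ht]; ring
  have e3 : newtonKernel p (q + 1) r = (√(t + 2 * q))⁻¹ := by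
    unfold newtonKernel; congr 2; rw [ht]; ring
  have e4 : newtonKernel p (q - 1) r = (√(t - 2 * q))⁻¹ := by
    unfold newtonKernel; congr 2; rw [ht]; ring
  have e5 : newtonKernel p q (r + 1) = (√(t + 2 * r))⁻¹ := by
    unfold newtonKernel; congr 2; rw [ht]; ring
  have e6 : newtonKernel p q (r - 1) = (√(t - 2 * r))⁻¹ := by
    unfold newtonKernel; congr 2; rw [ht]; ring
  rw [e1, e2, e3, e4, e5, e6]
  calc _ ≤ (√t)⁻¹ * (6 + 3 * (t - 9) / t ^ 2 + 16 * (t - 9) / t ^ 3) := by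
        refine (add_le_add (add_le_add hp hq) hr).trans (le_of_eq ?_)
        rw [ht]; ring
    _ ≤ (√t)⁻¹ * (6 * (1 + 1 / (2 * t))) := by
        refine mul_le_mul_of_nonneg_left ?_ (by positivity)
        have : 6 * (1 + 1 / (2 * t)) - (6 + 3 * (t - 9) / t ^ 2 + 16 * (t - 9) / t ^ 3) =
            (11 * t + 144) / t ^ 3 := by field_simp; ring
        have h2 : 0 ≤ (11 * t + 144) / t ^ 3 := by positivity
        linarith
    _ ≤ 6 * newtonKernel p q r := by linarith

theorem newtonKernel_le_inv_sqrt_mul (p q r : ℤ) :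
    newtonKernel p q r ≤ (√(p.natAbs + 1))⁻¹ * (√(q.natAbs + 1))⁻¹ := by
  unfold newtonKernel
  rw [← mul_inv, ← Real.sqrt_mul (by positivity)]
  refine inv_anti₀ (Real.sqrt_pos.2 (by positivity)) (Real.sqrt_le_sqrt ?_)
  rw [Nat.cast_natAbs, Nat.cast_natAbs, Int.cast_abs, Int.cast_abs]
  nlinarith [sq_nonneg (|(p : ℝ)| - |(q : ℝ)|), sq_nonneg (|(p : ℝ)| - 1),
    sq_nonneg (|(q : ℝ)| - 1), sq_abs (p : ℝ), sq_abs (q : ℝ), sq_nonneg (r : ℝ)]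

theorem newtonKernel_le_two_div (p q r : ℤ) :
    newtonKernel p q r ≤ 2 / (p.natAbs + 1) := by
  unfold newtonKernel
  rw [Nat.cast_natAbs, Int.cast_abs, inv_le_comm₀ (Real.sqrt_pos.2 (by positivity)) (by positivity),
    inv_div]
  apply Real.le_sqrt_of_sq_le
  nlinarith [sq_abs (p : ℝ), sq_nonneg (|(p : ℝ)| - 1), sq_nonneg (q : ℝ), sq_nonneg (r : ℝ)]

theorem inv_add_three_le_newtonKernel (n : ℕ) (q : ℝ) (hq : |q| ≤ n) :
    ((n : ℝ) + 3)⁻¹ ≤ newtonKernel 0 q 0 := by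
  unfold newtonKernel
  refine inv_anti₀ (Real.sqrt_pos.2 (by positivity)) (Real.sqrt_le_iff.2 ⟨by positivity, ?_⟩)
  nlinarith [sq_abs q, abs_nonneg q]

theorem sum_le_sum_range_card_of_antitone {φ : ℕ → ℝ} (hφ : Antitone φ) (T : Finset ℕ) :
    ∑ m ∈ T, φ m ≤ ∑ m ∈ Finset.range T.card, φ m := by
  induction T using Finset.induction_on_max with
  | empty => simp
  | insert a s hs ih =>
    have ha : a ∉ s := fun h => lt_irrefl _ (hs a h)
    have hc : s.card ≤ a := by
      simpa using Finset.card_le_card (s := s) (t := Finset.range a)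
        (fun x hx => Finset.mem_range.2 (hs x hx))
    rw [Finset.sum_insert ha, Finset.card_insert_of_notMem ha, Finset.sum_range_succ]
    linarith [hφ hc]

theorem sum_natAbs_sub_le {φ : ℕ → ℝ} (hφ : Antitone φ) (h0 : ∀ m, 0 ≤ φ m) (R : ℕ) (x : ℤ) :
    ∑ v ∈ Finset.range R, φ (x - v).natAbs ≤ 2 * ∑ m ∈ Finset.range R, φ m := by
  have aux : ∀ T ⊆ Finset.range R, Set.InjOn (fun v : ℕ => (x - v).natAbs) T →
      ∑ v ∈ T, φ (x - v).natAbs ≤ ∑ m ∈ Finset.range R, φ m := by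
    intro T hT hinj
    rw [← Finset.sum_image (f := φ) hinj]
    refine (sum_le_sum_range_card_of_antitone hφ _).trans ?_
    refine Finset.sum_le_sum_of_subset_of_nonneg ?_ (fun _ _ _ => h0 _)
    apply Finset.range_mono
    exact Finset.card_image_le.trans (by simpa using Finset.card_le_card hT)
  rw [← Finset.sum_filter_add_sum_filter_not (Finset.range R) (fun v : ℕ => (v : ℤ) ≤ x), two_mul]
  refine add_le_add (aux _ (Finset.filter_subset _ _) ?_) (aux _ (Finset.filter_subset _ _) ?_)
  · intro a ha b hb hab
    simp only [Finset.coe_filter, Set.mem_ofPred_eq] at ha hb hab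
    omega
  · intro a ha b hb hab
    simp only [Finset.coe_filter, Set.mem_ofPred_eq] at ha hb hab
    omega

theorem sum_range_inv_sqrt_le (n : ℕ) :
    ∑ m ∈ Finset.range n, (√((m : ℝ) + 1))⁻¹ ≤ 2 * √n := by
  induction n with
  | zero => simp
  | succ n ih =>
    rw [Finset.sum_range_succ]
    have h1 : 0 < √((n : ℝ) + 1) := Real.sqrt_pos.2 (by positivity)
    have h2 : √((n : ℝ) + 1) ^ 2 = n + 1 := Real.sq_sqrt (by positivity)
    have h3 : √(n : ℝ) ^ 2 = n := Real.sq_sqrt (by positivity)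
    have : (√((n : ℝ) + 1))⁻¹ ≤ 2 * √((n : ℝ) + 1) - 2 * √n := by
      rw [inv_le_iff_one_le_mul₀ h1]
      nlinarith [sq_nonneg (√((n : ℝ) + 1) - √n)]
    push_cast
    linarith

theorem sum_Ico_inv_le_log {a b : ℕ} (ha : 0 < a) (hab : a ≤ b) :
    ∑ m ∈ Finset.Ico a b, ((m : ℝ) + 1)⁻¹ ≤ Real.log (b / a) := by
  induction b, hab using Nat.le_induction with
  | base => simp [ha.ne']
  | succ b hb ih =>
    have hb0 : (0 : ℝ) < b := by exact_mod_cast ha.trans_le hb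
    have ha0 : (0 : ℝ) < a := by exact_mod_cast ha
    rw [Finset.sum_Ico_succ_top hb]
    have h := Real.one_sub_inv_le_log_of_pos (x := ((b : ℝ) + 1) / b) (by positivity)
    have e : 1 - (((b : ℝ) + 1) / b)⁻¹ = ((b : ℝ) + 1)⁻¹ := by field_simp; ring
    rw [e, Real.log_div (by positivity) hb0.ne'] at h
    rw [Real.log_div hb0.ne' ha0.ne'] at ih
    push_cast
    rw [Real.log_div (by positivity) ha0.ne']
    linarith

theorem log_le_sum_range_inv (n : ℕ) :
    Real.log ((n + 3) / 3) ≤ ∑ m ∈ Finset.range n, ((m : ℝ) + 3)⁻¹ := by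
  induction n with
  | zero => simp
  | succ n ih =>
    rw [Finset.sum_range_succ]
    have h := Real.log_le_sub_one_of_pos (x := ((n : ℝ) + 1 + 3) / (n + 3)) (by positivity)
    have e : ((n : ℝ) + 1 + 3) / (n + 3) - 1 = ((n : ℝ) + 3)⁻¹ := by field_simp; ring
    rw [e, Real.log_div (by positivity) (by positivity)] at h
    rw [Real.log_div (by positivity) (by positivity)] at ih
    push_cast
    rw [Real.log_div (by positivity) (by positivity)]
    linarith

/-- The path space cylinder of the paths that agree with `w` up to time `n`. -/
def pathCylinder {d : ℕ} (n : ℕ) (w : ℕ → Zd d) : Set (ℕ → Zd d) := {ω | ∀ k ≤ n, ω k = w k}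

/-- The `2 d` nearest neighbours of `x`. -/
def neighbour {d : ℕ} (x : Zd d) (p : Fin d × Bool) : Zd d :=
  if p.2 then x + Pi.single p.1 1 else x - Pi.single p.1 1

theorem exists_neighbour_eq_of_adj {d : ℕ} {x y : Zd d} (h : adj x y) :
    ∃ p, neighbour x p = y := by
  unfold adj at h
  have hne : ∃ i, x i ≠ y i := by
    by_contra! hc
    simp [hc] at h
  obtain ⟨i, hi⟩ := hne
  rw [← Finset.add_sum_erase _ _ (Finset.mem_univ i)] at h
  have hpos : 1 ≤ |x i - y i| := Int.one_le_abs (sub_ne_zero.2 hi)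
  have hrest : 0 ≤ ∑ j ∈ Finset.univ.erase i, |x j - y j| :=
    Finset.sum_nonneg fun _ _ => abs_nonneg _
  have h0 : ∑ j ∈ Finset.univ.erase i, |x j - y j| = 0 := by omega
  have h1 : |x i - y i| = 1 := by omega
  rw [Finset.sum_eq_zero_iff_of_nonneg fun _ _ => abs_nonneg _] at h0
  have heq : ∀ j, j ≠ i → x j = y j := fun j hj => by
    have := h0 j (by simp [hj])
    rwa [abs_eq_zero, sub_eq_zero] at this
  rcases (abs_eq zero_le_one).1 h1 with h2 | h2
  · refine ⟨(i, false), funext fun j => ?_⟩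
    by_cases hj : j = i
    · subst hj; simp [neighbour]; omega
    · simp [neighbour, hj, heq j hj]
  · refine ⟨(i, true), funext fun j => ?_⟩
    by_cases hj : j = i
    · subst hj; simp [neighbour]; omega
    · simp [neighbour, hj, heq j hj]

theorem measurableSet_pathCylinder {d : ℕ} (n : ℕ) (w : ℕ → Zd d) :
    MeasurableSet (pathCylinder n w) := by
  have : pathCylinder n w = ⋂ k, ⋂ (_ : k ≤ n), (fun ω : ℕ → Zd d => ω k) ⁻¹' {w k} := by
    ext ω; simp [pathCylinder]
  rw [this]
  exact MeasurableSet.iInter fun k => MeasurableSet.iInter fun _ =>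
    (measurable_pi_apply k) (measurableSet_singleton _)

theorem pathCylinder_eq_iUnion {d : ℕ} (n : ℕ) (w : ℕ → Zd d) :
    pathCylinder n w = ⋃ y, pathCylinder (n + 1) (Function.update w (n + 1) y) := by
  ext ω
  simp only [pathCylinder, Set.mem_ofPred_eq, Set.mem_iUnion]
  constructor
  · intro h
    refine ⟨ω (n + 1), fun k hk => ?_⟩
    rcases eq_or_ne k (n + 1) with rfl | hne
    · simp
    · rw [Function.update_of_ne hne]; exact h k (by omega)
  · rintro ⟨y, h⟩ k hk
    rw [h k (by omega), Function.update_of_ne (by omega)]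

theorem pairwise_disjoint_pathCylinder_update {d : ℕ} (n : ℕ) (w : ℕ → Zd d) :
    Pairwise (Function.onFun Disjoint
      fun y => pathCylinder (n + 1) (Function.update w (n + 1) y)) := by
  intro y z hyz
  refine Set.disjoint_left.2 fun ω h1 h2 => hyz ?_
  have e1 := h1 (n + 1) le_rfl
  have e2 := h2 (n + 1) le_rfl
  rw [Function.update_self] at e1 e2
  exact e1.symm.trans e2

namespace RI.IsSRW

variable {d : ℕ} {P : Zd d → Measure (ℕ → Zd d)}

theorem measure_pathCylinder_update_le (hP : IsSRW d P) (x : Zd d) (n : ℕ) (w : ℕ → Zd d)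
    (y : Zd d) :
    P x (pathCylinder (n + 1) (Function.update w (n + 1) y)) ≤
      (2 * d : ENNReal)⁻¹ * P x (pathCylinder n w) := by
  by_cases h : Function.update w (n + 1) y 0 = x ∧
      ∀ k < n + 1, adj (Function.update w (n + 1) y k) (Function.update w (n + 1) y (k + 1))
  · have hw : w 0 = x ∧ ∀ k < n, adj (w k) (w (k + 1)) := by
      refine ⟨by simpa using h.1, fun k hk => ?_⟩
      have := h.2 k (by omega)
      rwa [Function.update_of_ne (by omega), Function.update_of_ne (by omega)] at this
    refine ((hP.2.1 x (n + 1) _ h).trans ?_).le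
    rw [pathCylinder, hP.2.1 x n w hw, pow_succ']
  · exact (hP.2.2 x (n + 1) _ h).trans_le zero_le

theorem measure_pathCylinder_update_eq_zero (hP : IsSRW d P) (x : Zd d) (n : ℕ) (w : ℕ → Zd d)
    {y : Zd d} (hy : ¬ adj (w n) y) :
    P x (pathCylinder (n + 1) (Function.update w (n + 1) y)) = 0 := by
  refine hP.2.2 x (n + 1) _ fun h => hy ?_
  have := h.2 n (by omega)
  rwa [Function.update_of_ne (by omega), Function.update_self] at this

theorem setLIntegral_pathCylinder_le (hP : IsSRW d P) (hd : 0 < d)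
    {Ψ : ℕ → (ℕ → Zd d) → ENNReal}
    (hadapted : ∀ n w w', (∀ k ≤ n, w k = w' k) → Ψ n w = Ψ n w')
    (hsuper : ∀ n w, ∑ p, Ψ (n + 1) (Function.update w (n + 1) (neighbour (w n) p)) ≤
      2 * d * Ψ n w) (x : Zd d) (m n : ℕ) (w : ℕ → Zd d) :
    ∫⁻ ω in pathCylinder n w, Ψ (n + m) ω ∂(P x) ≤ P x (pathCylinder n w) * Ψ n w := by
  classical
  induction m generalizing n w with
  | zero =>
    rw [add_zero, setLIntegral_congr_fun (g := fun _ => Ψ n w) (measurableSet_pathCylinder n w)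
      (fun ω hω => hadapted n ω w hω), setLIntegral_const, mul_comm]
  | succ m ih =>
    rw [pathCylinder_eq_iUnion n w, lintegral_iUnion (fun _ => measurableSet_pathCylinder _ _)
      (pairwise_disjoint_pathCylinder_update n w), ← pathCylinder_eq_iUnion]
    set F : Zd d → ENNReal := fun y =>
      P x (pathCylinder (n + 1) (Function.update w (n + 1) y)) *
        Ψ (n + 1) (Function.update w (n + 1) y) with hF
    have hd0 : (2 * d : ENNReal) ≠ 0 := by simp [hd.ne']
    have hdt : (2 * d : ENNReal) ≠ ⊤ := ENNReal.mul_ne_top (by simp) (by simp)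
    calc _ ≤ ∑' y, F y := ENNReal.tsum_le_tsum fun y => by
          have := ih (n + 1) (Function.update w (n + 1) y)
          rwa [show n + 1 + m = n + (m + 1) by omega] at this
      _ = ∑ y ∈ Finset.univ.image (neighbour (w n)), F y := by
          refine tsum_eq_sum fun y hy => ?_
          rw [hF]
          simp only
          rw [hP.measure_pathCylinder_update_eq_zero, zero_mul]
          intro hadj
          obtain ⟨p, hp⟩ := exists_neighbour_eq_of_adj hadj
          exact hy (Finset.mem_image.2 ⟨p, Finset.mem_univ _, hp⟩)
      _ ≤ ∑ p, F (neighbour (w n) p) :=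
          Finset.sum_image_le_of_nonneg (fun _ _ => zero_le)
      _ ≤ ∑ p, (2 * d : ENNReal)⁻¹ * P x (pathCylinder n w) *
            Ψ (n + 1) (Function.update w (n + 1) (neighbour (w n) p)) :=
          Finset.sum_le_sum fun p _ =>
            mul_le_mul_left (hP.measure_pathCylinder_update_le x n w _) _
      _ = (2 * d : ENNReal)⁻¹ * P x (pathCylinder n w) *
            ∑ p, Ψ (n + 1) (Function.update w (n + 1) (neighbour (w n) p)) :=
          (Finset.mul_sum _ _ _).symm
      _ ≤ (2 * d : ENNReal)⁻¹ * P x (pathCylinder n w) * (2 * d * Ψ n w) := by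
          gcongr; exact hsuper n w
      _ = ((2 * d : ENNReal)⁻¹ * (2 * d)) * (P x (pathCylinder n w) * Ψ n w) := by ring
      _ = P x (pathCylinder n w) * Ψ n w := by
          rw [ENNReal.inv_mul_cancel hd0 hdt, one_mul]

theorem lintegral_le_of_supermartingale (hP : IsSRW d P) (hd : 0 < d)
    {Ψ : ℕ → (ℕ → Zd d) → ENNReal}
    (hadapted : ∀ n w w', (∀ k ≤ n, w k = w' k) → Ψ n w = Ψ n w')
    (hsuper : ∀ n w, ∑ p, Ψ (n + 1) (Function.update w (n + 1) (neighbour (w n) p)) ≤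
      2 * d * Ψ n w) (x : Zd d) (n : ℕ) :
    ∫⁻ ω, Ψ n ω ∂(P x) ≤ Ψ 0 fun _ => x := by
  have := hP.1 x
  have h1 : P x (pathCylinder 0 fun _ => x) = 1 := by
    have := hP.2.1 x 0 (fun _ => x) ⟨rfl, by simp⟩
    rwa [pow_zero] at this
  have h2 : (pathCylinder 0 fun _ => x) =ᵐ[P x] (Set.univ : Set (ℕ → Zd d)) := by
    rw [ae_eq_univ]
    exact (prob_compl_eq_zero_iff (measurableSet_pathCylinder _ _)).2 h1
  have h3 := hP.setLIntegral_pathCylinder_le hd hadapted hsuper x n 0 fun _ => x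
  rwa [setLIntegral_congr h2, setLIntegral_univ, h1, one_mul, zero_add] at h3

end RI.IsSRW

/-- `h` is superharmonic for the simple random walk. -/
def IsSuperharmonic {d : ℕ} (h : Zd d → ℝ) : Prop :=
  ∀ x, ∑ p, h (neighbour x p) ≤ 2 * d * h x

open scoped Classical in
/-- The indices of the sets visited by `w` up to time `n`. -/
noncomputable def visited {d : ℕ} {ι : Type*} (s : Finset ι) (S : ι → Set (Zd d)) (n : ℕ)
    (w : ℕ → Zd d) : Finset ι :=
  {i ∈ s | ∃ m ≤ n, w m ∈ S i}

open scoped Classical in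
theorem exp_card_mul_le {ι : Type*} {s D D' : Finset ι} {l : ℝ} {f : ι → ℝ}
    (hl : 0 ≤ l) (hf : ∀ i ∈ s, 0 ≤ f i) (hsum : 2 * l * ∑ i ∈ s, f i ≤ 1) (hDD : D ⊆ D')
    (hDs : D' ⊆ s) (hone : ∀ i ∈ D' \ D, 1 ≤ f i) :
    Real.exp (l * D'.card) * (1 + 2 * l * ∑ i ∈ s \ D', f i) ≤
      Real.exp (l * D.card) * (1 + 2 * l * ∑ i ∈ s \ D, f i) := by
  have hcard : (D'.card : ℝ) = D.card + (D' \ D).card := by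
    rw [add_comm]
    exact_mod_cast (Finset.card_sdiff_add_card_eq_card hDD).symm
  have hsplit : ∑ i ∈ s \ D, f i = ∑ i ∈ s \ D', f i + ∑ i ∈ D' \ D, f i := by
    rw [← Finset.sum_union]
    · congr 1
      ext i
      have h1 := @hDD i
      have h2 := @hDs i
      simp only [Finset.mem_sdiff, Finset.mem_union]
      tauto
    · exact Finset.disjoint_left.2 fun i hi hj => by
        simp only [Finset.mem_sdiff] at hi hj
        exact hi.2 hj.1
  have hr : ((D' \ D).card : ℝ) ≤ ∑ i ∈ D' \ D, f i := by
    have := Finset.card_nsmul_le_sum _ _ _ hone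
    simpa using this
  have hF : 2 * l * ∑ i ∈ s \ D, f i ≤ 1 := by
    refine le_trans ?_ hsum
    gcongr 2 * l * ?_
    exact Finset.sum_le_sum_of_subset_of_nonneg Finset.sdiff_subset fun i hi _ => hf i hi
  have h0 : 0 ≤ ∑ i ∈ s \ D', f i :=
    Finset.sum_nonneg fun i hi => hf i (Finset.sdiff_subset hi)
  rw [hcard, mul_add l, Real.exp_add, mul_assoc]
  refine mul_le_mul_of_nonneg_left ?_ (Real.exp_pos _).le
  set r : ℝ := ((D' \ D).card : ℝ)
  set F := 2 * l * ∑ i ∈ s \ D, f i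
  have hr0 : 0 ≤ l * r := mul_nonneg hl (Nat.cast_nonneg _)
  have hstep : 1 + 2 * l * ∑ i ∈ s \ D', f i ≤ (1 + F) * (1 - l * r) := by
    have e : 2 * l * ∑ i ∈ s \ D', f i = F - 2 * l * ∑ i ∈ D' \ D, f i := by
      simp only [F]; rw [hsplit]; ring
    have : 2 * l * r ≤ 2 * l * ∑ i ∈ D' \ D, f i := by gcongr
    nlinarith [mul_nonneg hr0 (sub_nonneg.2 hF)]
  have hF0 : 0 ≤ 1 + F := by
    have : 0 ≤ ∑ i ∈ s \ D, f i := Finset.sum_nonneg fun i hi => hf i (Finset.sdiff_subset hi)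
    positivity
  have hexp : Real.exp (l * r) * (1 - l * r) ≤ 1 := by
    have := Real.one_sub_le_exp_neg (l * r)
    calc _ ≤ Real.exp (l * r) * Real.exp (-(l * r)) := by gcongr
      _ = 1 := by rw [← Real.exp_add]; simp
  calc _ ≤ Real.exp (l * r) * ((1 + F) * (1 - l * r)) := by gcongr
    _ = (1 + F) * (Real.exp (l * r) * (1 - l * r)) := by ring
    _ ≤ (1 + F) * 1 := by gcongr
    _ = 1 + F := mul_one _

open scoped Classical in
/-- A Khasminskii-type bound on the number of sets visited by the walk up to time `n`. -/
theorem RI.IsSRW.lintegral_exp_card_visited_le {d : ℕ} {P : Zd d → Measure (ℕ → Zd d)}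
    (hP : IsSRW d P) (hd : 0 < d) {ι : Type*} {s : Finset ι} {S : ι → Set (Zd d)}
    {h : ι → Zd d → ℝ} {l : ℝ} (hl : 0 ≤ l) (h0 : ∀ i x, 0 ≤ h i x)
    (hsh : ∀ i, IsSuperharmonic (h i)) (hone : ∀ i ∈ s, ∀ x ∈ S i, 1 ≤ h i x)
    (hsum : ∀ x, 2 * l * ∑ i ∈ s, h i x ≤ 1) (x : Zd d) (n : ℕ) :
    ∫⁻ ω, ENNReal.ofReal (Real.exp (l * (visited s S n ω).card)) ∂(P x) ≤ 2 := by
  set Φ : ℕ → (ℕ → Zd d) → ℝ := fun n w =>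
    Real.exp (l * (visited s S n w).card) * (1 + 2 * l * ∑ i ∈ s \ visited s S n w, h i (w n))
    with hΦ
  have hnn : ∀ (D : Finset ι) y, 0 ≤ ∑ i ∈ s \ D, h i y :=
    fun D y => Finset.sum_nonneg fun i _ => h0 i y
  have hΦ0 : ∀ n w, 0 ≤ Φ n w := fun n w =>
    mul_nonneg (Real.exp_pos _).le (by have := hnn (visited s S n w) (w n); positivity)
  have hvis : ∀ n w w', (∀ k ≤ n, w k = w' k) → visited s S n w = visited s S n w' := by
    intro n w w' hw
    refine Finset.filter_congr fun i _ => exists_congr fun m => ?_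
    exact and_congr_right fun hm => by rw [hw m hm]
  have key := hP.lintegral_le_of_supermartingale hd (Ψ := fun n w => ENNReal.ofReal (Φ n w))
    (fun n w w' hw => by simp only [hΦ]; rw [hvis n w w' hw, hw n le_rfl]) ?_ x n
  · refine (lintegral_mono fun ω => ?_).trans (key.trans ?_)
    · refine ENNReal.ofReal_le_ofReal (le_mul_of_one_le_right (Real.exp_pos _).le ?_)
      have := hnn (visited s S n ω) (ω n)
      have : 0 ≤ 2 * l * ∑ i ∈ s \ visited s S n ω, h i (ω n) := by positivity
      linarith
    · rw [← ENNReal.ofReal_ofNat 2]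
      refine ENNReal.ofReal_le_ofReal ?_
      have := exp_card_mul_le (D := ∅) (D' := visited s S 0 fun _ => x) hl
        (fun i _ => h0 i x) (hsum x) (Finset.empty_subset _) (Finset.filter_subset _ _) ?_
      · refine this.trans ?_
        have := hsum x
        simp only [Finset.card_empty, Nat.cast_zero, mul_zero, Real.exp_zero, one_mul,
          Finset.sdiff_empty]
        linarith
      · intro i hi
        simp only [visited, Finset.sdiff_empty, Finset.mem_filter] at hi
        obtain ⟨his, m, -, hm⟩ := hi
        exact hone i his x hm
  · intro n w
    rw [← ENNReal.ofReal_sum_of_nonneg fun _ _ => hΦ0 _ _,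
      show (2 * d : ENNReal) = ENNReal.ofReal (2 * d) by
        rw [ENNReal.ofReal_mul zero_le_two]; simp,
      ← ENNReal.ofReal_mul (by positivity)]
    refine ENNReal.ofReal_le_ofReal ?_
    set D := visited s S n w
    have hstep : ∀ y, Φ (n + 1) (Function.update w (n + 1) y) ≤
        Real.exp (l * D.card) * (1 + 2 * l * ∑ i ∈ s \ D, h i y) := by
      intro y
      have hD : D = visited s S n (Function.update w (n + 1) y) :=
        hvis n _ _ fun k hk => by rw [Function.update_of_ne (by omega)]
      simp only [hΦ]
      rw [Function.update_self]
      refine exp_card_mul_le hl (fun i _ => h0 i y) (hsum y) ?_ (Finset.filter_subset _ _) ?_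
      · rw [hD]
        refine Finset.monotone_filter_right _ fun i _ => ?_
        rintro ⟨m, hm, hmem⟩
        exact ⟨m, by omega, hmem⟩
      · intro i hi
        rw [hD] at hi
        simp only [visited, Finset.mem_sdiff, Finset.mem_filter, not_and] at hi
        obtain ⟨⟨his, m, hm, hmem⟩, hno⟩ := hi
        rcases eq_or_ne m (n + 1) with rfl | hne
        · rw [Function.update_self] at hmem
          exact hone i his y hmem
        · exact absurd ⟨m, by omega, hmem⟩ (hno his)
    calc _ ≤ ∑ p, Real.exp (l * D.card) * (1 + 2 * l * ∑ i ∈ s \ D, h i (neighbour (w n) p)) :=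
          Finset.sum_le_sum fun p _ => hstep _
      _ = Real.exp (l * D.card) *
            (2 * d + 2 * l * ∑ i ∈ s \ D, ∑ p, h i (neighbour (w n) p)) := by
          rw [← Finset.mul_sum, Finset.sum_add_distrib, ← Finset.mul_sum, Finset.sum_comm]
          simp [mul_comm]
      _ ≤ Real.exp (l * D.card) * (2 * d + 2 * l * ∑ i ∈ s \ D, 2 * d * h i (w n)) := by
          gcongr with i _
          exact hsh i (w n)
      _ = 2 * d * Φ n w := by
          simp only [hΦ]
          rw [← Finset.mul_sum]
          ring

open scoped Classical in
theorem RI.IsSRW.integral_exp_sum_indicator_le {d : ℕ} {P : Zd d → Measure (ℕ → Zd d)}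
    (hP : IsSRW d P) (hd : 0 < d) {ι : Type*} {s : Finset ι} {S : ι → Set (Zd d)}
    {h : ι → Zd d → ℝ} {l : ℝ} (hl : 0 ≤ l) (h0 : ∀ i x, 0 ≤ h i x)
    (hsh : ∀ i, IsSuperharmonic (h i)) (hone : ∀ i ∈ s, ∀ x ∈ S i, 1 ≤ h i x)
    (hsum : ∀ x, 2 * l * ∑ i ∈ s, h i x ≤ 1) (x : Zd d) :
    ∫ ω, Real.exp (l * ∑ i ∈ s,
      ({ω' : ℕ → Zd d | ∃ m, ω' m ∈ S i}.indicator (fun _ => (1 : ℝ)) ω)) ∂(P x) ≤ 2 := by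
  set f : (ℕ → Zd d) → ℝ := fun ω => Real.exp (l * ∑ i ∈ s,
      ({ω' : ℕ → Zd d | ∃ m, ω' m ∈ S i}.indicator (fun _ => (1 : ℝ)) ω)) with hf
  set g : ℕ → (ℕ → Zd d) → ENNReal := fun n ω =>
    ENNReal.ofReal (Real.exp (l * (visited s S n ω).card)) with hg
  have hmeas : ∀ n, Measurable (g n) := by
    intro n
    have hcard : ∀ ω, ((visited s S n ω).card : ℝ) =
        ∑ i ∈ s, ({ω' : ℕ → Zd d | ∃ m ≤ n, ω' m ∈ S i}.indicator (fun _ => (1 : ℝ)) ω) := by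
      intro ω
      simp [visited, Set.indicator_apply, Finset.sum_boole]
    simp only [hg, hcard]
    refine ENNReal.measurable_ofReal.comp (Real.measurable_exp.comp
      (measurable_const.mul (Finset.measurable_sum _ fun i _ => ?_)))
    refine measurable_const.indicator ?_
    have : {ω' : ℕ → Zd d | ∃ m ≤ n, ω' m ∈ S i} =
        ⋃ m, ⋃ (_ : m ≤ n), (fun ω' : ℕ → Zd d => ω' m) ⁻¹' S i := by
      ext; simp
    rw [this]
    exact MeasurableSet.iUnion fun m => MeasurableSet.iUnion fun _ =>
      (measurable_pi_apply m) (Set.to_countable _).measurableSet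
  have hlim : ∀ ω, ∀ᶠ n in atTop, g n ω = ENNReal.ofReal (f ω) := by
    intro ω
    have : ∀ i ∈ s, ∀ᶠ n in atTop, ((∃ m ≤ n, ω m ∈ S i) ↔ ∃ m, ω m ∈ S i) := by
      intro i _
      by_cases hex : ∃ m, ω m ∈ S i
      · obtain ⟨m, hm⟩ := hex
        filter_upwards [eventually_ge_atTop m] with n hn
        exact ⟨fun _ => ⟨m, hm⟩, fun _ => ⟨m, hn, hm⟩⟩
      · exact Eventually.of_forall fun n => ⟨fun ⟨m, _, hm⟩ => ⟨m, hm⟩, fun hc => absurd hc hex⟩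
    filter_upwards [(eventually_all_finset s).2 this] with n hn
    simp only [hg, hf, visited]
    rw [Finset.filter_congr hn]
    simp [Set.indicator_apply, Finset.sum_boole]
  have hlint : ∫⁻ ω, ENNReal.ofReal (f ω) ∂(P x) ≤ 2 := by
    calc _ ≤ ∫⁻ ω, liminf (fun n => g n ω) atTop ∂(P x) := by
          refine lintegral_mono fun ω => ?_
          rw [(tendsto_const_nhds.congr' ((hlim ω).mono fun _ h => h.symm)).liminf_eq]
      _ ≤ liminf (fun n => ∫⁻ ω, g n ω ∂(P x)) atTop := lintegral_liminf_le hmeas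
      _ ≤ 2 := liminf_le_of_le (by isBoundedDefault) fun b hb => by
          obtain ⟨n, hn⟩ := hb.exists
          exact hn.trans (hP.lintegral_exp_card_visited_le hd hl h0 hsh hone hsum x n)
  by_cases hint : Integrable f (P x)
  · rw [integral_eq_lintegral_of_nonneg_ae (Eventually.of_forall fun ω => (Real.exp_pos _).le)
      hint.aestronglyMeasurable]
    exact ENNReal.toReal_le_of_le_ofReal zero_le_two (by simpa using hlint)
  · rw [integral_undef hint]
    exact zero_le_two

/-- The potential generated at `x` by the vertical segment `{v} × [b, b + L]` of the plane. -/
noncomputable def segmentPotential {d : ℕ} (L : ℕ) (v b : ℤ) (x : Zd d) : ℝ :=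
  ∑ q ∈ Finset.range (L + 1),
    newtonKernel ((coord x 0 : ℝ) - v) ((coord x 1 : ℝ) - (b + q)) (coord x 2)

theorem newtonKernel_nonneg (p q r : ℝ) : 0 ≤ newtonKernel p q r :=
  inv_nonneg.2 (Real.sqrt_nonneg _)

theorem segmentPotential_nonneg {d : ℕ} (L : ℕ) (v b : ℤ) (x : Zd d) :
    0 ≤ segmentPotential L v b x :=
  Finset.sum_nonneg fun _ _ => newtonKernel_nonneg _ _ _

theorem isSuperharmonic_newtonKernel {d : ℕ} (hd : 3 ≤ d) (a b : ℝ) :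
    IsSuperharmonic fun x : Zd d =>
      newtonKernel ((coord x 0 : ℝ) - a) ((coord x 1 : ℝ) - b) (coord x 2) := by
  obtain ⟨n, rfl⟩ := Nat.exists_eq_add_of_le' hd
  intro x
  have key := newtonKernel_neighbour_sum_le ((x 0 : ℝ) - a) ((x 1 : ℝ) - b) (x 2)
  have hcoord : ∀ y : Zd (n + 3), coord y 0 = y 0 ∧ coord y 1 = y 1 ∧ coord y 2 = y 2 := by
    intro y
    refine ⟨?_, ?_, ?_⟩ <;> simp only [coord] <;> rw [dif_pos (by omega)] <;> rfl
  simp only [Fintype.sum_prod_type, Fintype.sum_bool, neighbour, hcoord]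
  rw [Fin.sum_univ_succ, Fin.sum_univ_succ, Fin.sum_univ_succ]
  have val_two : ((2 : Fin (n + 3)) : ℕ) = 2 :=
    Nat.mod_eq_of_lt (show 2 < n + 3 by omega)
  have e0 : ∀ i : Fin n, (0 : Fin (n + 3)) ≠ i.succ.succ.succ := fun i => by
    simp [Fin.ext_iff]
  have e1 : ∀ i : Fin n, (1 : Fin (n + 3)) ≠ i.succ.succ.succ := fun i => by
    simp [Fin.ext_iff]
  have e2 : ∀ i : Fin n, (2 : Fin (n + 3)) ≠ i.succ.succ.succ := fun i => by
    simp only [ne_eq, Fin.ext_iff, Fin.val_succ, val_two]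
    omega
  have e3 : (0 : Fin (n + 3)) ≠ 1 := by simp
  have e4 : (0 : Fin (n + 3)) ≠ 2 := by rw [ne_eq, Fin.ext_iff, val_two]; simp
  have e5 : (1 : Fin (n + 3)) ≠ 2 := by rw [ne_eq, Fin.ext_iff, val_two]; simp
  have s1 : (Fin.succ (0 : Fin (n + 2))) = 1 := rfl
  have s2 : (Fin.succ (Fin.succ (0 : Fin (n + 1)))) = 2 := rfl
  simp only [s1, s2, if_true, Bool.false_eq_true, if_false, Pi.add_apply, Pi.sub_apply,
    Pi.single_eq_same, Pi.single_eq_of_ne (e0 _), Pi.single_eq_of_ne (e1 _),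
    Pi.single_eq_of_ne (e2 _), Pi.single_eq_of_ne e3, Pi.single_eq_of_ne e3.symm,
    Pi.single_eq_of_ne e4, Pi.single_eq_of_ne e4.symm, Pi.single_eq_of_ne e5,
    Pi.single_eq_of_ne e5.symm, add_zero, sub_zero, Finset.sum_const, Finset.card_univ,
    Fintype.card_fin, nsmul_eq_mul]
  push_cast
  rw [add_sub_right_comm, sub_right_comm (x 0 : ℝ), add_sub_right_comm (x 1 : ℝ),
    sub_right_comm (x 1 : ℝ)]
  linarith

theorem isSuperharmonic_segmentPotential {d : ℕ} (hd : 3 ≤ d) (L : ℕ) (v b : ℤ) :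
    IsSuperharmonic (segmentPotential (d := d) L v b) := by
  intro x
  unfold segmentPotential
  rw [Finset.sum_comm, Finset.mul_sum]
  exact Finset.sum_le_sum fun q _ => isSuperharmonic_newtonKernel hd v (b + q) x

theorem half_log_le_segmentPotential {d : ℕ} {L : ℕ} (hL : 36 ≤ L) {v b : ℤ} {x : Zd d}
    (hx : inPlane x) (h0 : coord x 0 = v) (h1 : b ≤ coord x 1) (h2 : coord x 1 ≤ b + L) :
    Real.log L / 2 ≤ segmentPotential L v b x := by
  have hc2 : coord x 2 = 0 := by
    unfold coord
    split
    · exact hx _ le_rfl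
    · rfl
  obtain ⟨p, hp⟩ := Int.eq_ofNat_of_zero_le (sub_nonneg.2 h1)
  have hpL : p ≤ L := by omega
  have hc1 : (coord x 1 : ℝ) = b + p := by exact_mod_cast (by omega : coord x 1 = b + p)
  have hlog : Real.log L / 2 ≤ Real.log (((L / 2 + 1 : ℕ) + 3) / 3) := by
    have hL' : (36 : ℝ) ≤ L := by exact_mod_cast hL
    rw [div_le_iff₀ two_pos, mul_comm, ← Nat.cast_two (R := ℝ), ← Real.log_pow]
    refine Real.log_le_log (by linarith) ?_
    have : (L : ℝ) ≤ 2 * (L / 2 : ℕ) + 1 := by exact_mod_cast (by omega : L ≤ 2 * (L / 2) + 1)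
    push_cast at this ⊢
    have h6 : (L : ℝ) / 6 ≤ ((L / 2 : ℕ) + 1 + 3) / 3 := by linarith
    calc (L : ℝ) ≤ (L / 6) ^ 2 := by nlinarith
      _ ≤ _ := by gcongr
  refine hlog.trans ((log_le_sum_range_inv _).trans ?_)
  have aux : ∀ φ : ℕ → ℕ, Set.InjOn φ (Finset.range (L / 2 + 1)) →
      (∀ m ∈ Finset.range (L / 2 + 1), φ m ∈ Finset.range (L + 1)) →
      (∀ m ∈ Finset.range (L / 2 + 1), |((p : ℝ) - φ m)| ≤ m) →
      ∑ m ∈ Finset.range (L / 2 + 1), ((m : ℝ) + 3)⁻¹ ≤ segmentPotential L v b x := by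
    intro φ hinj hmem habs
    calc _ ≤ ∑ m ∈ Finset.range (L / 2 + 1), newtonKernel 0 ((p : ℝ) - φ m) 0 :=
          Finset.sum_le_sum fun m hm => inv_add_three_le_newtonKernel m _ (habs m hm)
      _ = ∑ q ∈ (Finset.range (L / 2 + 1)).image φ, newtonKernel 0 ((p : ℝ) - q) 0 :=
          (Finset.sum_image (f := fun q : ℕ => newtonKernel 0 ((p : ℝ) - q) 0) hinj).symm
      _ ≤ ∑ q ∈ Finset.range (L + 1), newtonKernel 0 ((p : ℝ) - q) 0 :=
          Finset.sum_le_sum_of_subset_of_nonneg (Finset.image_subset_iff.2 hmem)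
            fun _ _ _ => newtonKernel_nonneg _ _ _
      _ = segmentPotential L v b x := by
          unfold segmentPotential
          rw [h0, hc1, hc2]
          simp
  rcases le_total p (L / 2) with hle | hle
  · refine aux (fun m => p + m) (fun a _ b _ h => by simpa using h) (fun m hm => ?_) fun m _ => ?_
    · simp only [Finset.mem_range] at hm ⊢; omega
    · simp
  · refine aux (fun m => p - m) (fun a ha b hb h => ?_) (fun m hm => ?_) fun m hm => ?_
    · simp only [Finset.coe_range, Set.mem_Iio] at ha hb h; omega
    · simp only [Finset.mem_range] at hm ⊢; omega
    · rw [Nat.cast_sub (by simp only [Finset.mem_range] at hm; omega)]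
      simp

theorem segmentPotential_le {d : ℕ} (L : ℕ) (v b : ℤ) (x : Zd d) :
    segmentPotential L v b x ≤
      min (4 * √((L : ℝ) + 1) * (√((coord x 0 - v).natAbs + 1))⁻¹)
        (2 * ((L : ℝ) + 1) * (((coord x 0 - v).natAbs : ℝ) + 1)⁻¹) := by
  have hcast : segmentPotential L v b x = ∑ q ∈ Finset.range (L + 1),
      newtonKernel ((coord x 0 - v : ℤ) : ℝ) (((coord x 1 - b) - q : ℤ) : ℝ)
        ((coord x 2 : ℤ) : ℝ) := by
    unfold segmentPotential
    refine Finset.sum_congr rfl fun q _ => ?_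
    push_cast
    rw [sub_sub]
  rw [hcast]
  refine le_min ?_ ?_
  · calc _ ≤ ∑ q ∈ Finset.range (L + 1), (√((coord x 0 - v).natAbs + 1))⁻¹ *
            (√(((coord x 1 - b) - q).natAbs + 1))⁻¹ :=
          Finset.sum_le_sum fun q _ => newtonKernel_le_inv_sqrt_mul _ _ _
      _ = (√((coord x 0 - v).natAbs + 1))⁻¹ *
            ∑ q ∈ Finset.range (L + 1), (√(((coord x 1 - b) - q).natAbs + 1))⁻¹ :=
          (Finset.mul_sum _ _ _).symm
      _ ≤ (√((coord x 0 - v).natAbs + 1))⁻¹ * (2 * (2 * √((L + 1 : ℕ)))) := by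
          gcongr
          refine (sum_natAbs_sub_le (φ := fun m => (√((m : ℝ) + 1))⁻¹) ?_ ?_ _ _).trans ?_
          · intro m m' hm
            simp only
            gcongr
          · intro m; positivity
          · gcongr; exact sum_range_inv_sqrt_le _
      _ = _ := by push_cast; ring
  · calc _ ≤ ∑ q ∈ Finset.range (L + 1), (2 / (((coord x 0 - v).natAbs : ℝ) + 1)) :=
          Finset.sum_le_sum fun q _ => newtonKernel_le_two_div _ _ _
      _ = _ := by
          rw [Finset.sum_const, Finset.card_range, nsmul_eq_mul]; push_cast; ring

theorem sum_range_mul_eq (f : ℕ → ℝ) (K L : ℕ) :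
    ∑ k ∈ Finset.range K, ∑ j ∈ Finset.range L, f (k * L + j) =
      ∑ v ∈ Finset.range (K * L), f v := by
  induction K with
  | zero => simp
  | succ K ih => rw [Finset.sum_range_succ, ih, Nat.succ_mul, Finset.sum_range_add]

theorem sum_segmentPotential_le {d : ℕ} {K L : ℕ} (hK : 1 ≤ K) (hL : 1 ≤ L) (b : ℕ → ℤ)
    (x : Zd d) :
    ∑ k ∈ Finset.range K, ∑ j ∈ Finset.range L, segmentPotential L (k * L + j) (b k) x ≤
      L * (32 + 8 * Real.log K) := by
  set φ : ℕ → ℝ := fun m =>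
    min (4 * √((L : ℝ) + 1) * (√((m : ℝ) + 1))⁻¹) (2 * ((L : ℝ) + 1) * ((m : ℝ) + 1)⁻¹) with hφ
  have hanti : Antitone φ := by
    intro m m' hm
    simp only [hφ]
    gcongr
  have h0 : ∀ m, 0 ≤ φ m := fun m => le_min (by positivity) (by positivity)
  have hL0 : (1 : ℝ) ≤ L := by exact_mod_cast hL
  have hLK : L ≤ K * L := Nat.le_mul_of_pos_left _ hK
  have hnear : ∑ m ∈ Finset.range L, φ m ≤ 8 * (L + 1) := by
    calc _ ≤ ∑ m ∈ Finset.range L, 4 * √((L : ℝ) + 1) * (√((m : ℝ) + 1))⁻¹ :=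
          Finset.sum_le_sum fun m _ => min_le_left _ _
      _ ≤ 4 * √((L : ℝ) + 1) * (2 * √L) := by
          rw [← Finset.mul_sum]; gcongr; exact sum_range_inv_sqrt_le _
      _ ≤ 4 * √((L : ℝ) + 1) * (2 * √((L : ℝ) + 1)) := by gcongr; linarith
      _ = 8 * (√((L : ℝ) + 1) * √((L : ℝ) + 1)) := by ring
      _ = 8 * (L + 1) := by rw [Real.mul_self_sqrt (by positivity)]
  have hfar : ∑ m ∈ Finset.Ico L (K * L), φ m ≤ 2 * (L + 1) * Real.log K := by
    calc _ ≤ ∑ m ∈ Finset.Ico L (K * L), 2 * ((L : ℝ) + 1) * ((m : ℝ) + 1)⁻¹ :=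
          Finset.sum_le_sum fun m _ => min_le_right _ _
      _ ≤ 2 * (L + 1) * Real.log ((K * L : ℕ) / L) := by
          rw [← Finset.mul_sum]; gcongr; exact sum_Ico_inv_le_log hL hLK
      _ = _ := by push_cast; rw [mul_div_cancel_right₀ _ (by positivity)]
  have hlogK : 0 ≤ Real.log K := Real.log_natCast_nonneg K
  calc _ ≤ ∑ k ∈ Finset.range K, ∑ j ∈ Finset.range L,
          φ (coord x 0 - ((k * L + j : ℕ) : ℤ)).natAbs := by
        refine Finset.sum_le_sum fun k _ => Finset.sum_le_sum fun j _ => ?_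
        have := segmentPotential_le L (k * L + j) (b k) x
        simpa [hφ] using this
    _ = ∑ v ∈ Finset.range (K * L), φ (coord x 0 - (v : ℤ)).natAbs :=
        sum_range_mul_eq (fun v => φ (coord x 0 - (v : ℤ)).natAbs) K L
    _ ≤ 2 * ∑ m ∈ Finset.range (K * L), φ m := sum_natAbs_sub_le hanti h0 _ _
    _ ≤ 2 * (8 * (L + 1) + 2 * (L + 1) * Real.log K) := by
        rw [← Finset.sum_range_add_sum_Ico _ hLK]
        gcongr
    _ = (L + 1) * (16 + 4 * Real.log K) := by ring
    _ ≤ (2 * L) * (16 + 4 * Real.log K) := by gcongr; linarith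
    _ = _ := by ring

theorem scale_bounds {L0 : ℕ} (h : Real.exp 1000 ≤ (L0 : ℝ)) :
    36 ≤ Lof L0 ∧ 1 ≤ Real.log ((L0 : ℝ) / Lof L0) := by
  have hL0 : (0 : ℝ) < L0 := (Real.exp_pos _).trans_le h
  have hlog : 1000 ≤ Real.log L0 := (Real.le_log_iff_exp_le hL0).2 h
  set s := (Real.log L0) ^ ((1 : ℝ) / 3) with hs
  have hs10 : 10 ≤ s := by
    calc (10 : ℝ) = (1000 : ℝ) ^ ((1 : ℝ) / 3) := by
          rw [show (1000 : ℝ) = 10 ^ (3 : ℝ) by norm_num, ← Real.rpow_mul (by norm_num)]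
          norm_num
      _ ≤ s := Real.rpow_le_rpow (by norm_num) hlog (by norm_num)
  have hslog : s ≤ Real.log L0 := by
    calc s ≤ (Real.log L0) ^ (1 : ℝ) :=
          Real.rpow_le_rpow_of_exponent_le (by linarith) (by norm_num)
      _ = _ := Real.rpow_one _
  have hM : 1 ≤ Mof L0 := by
    unfold Mof
    rw [Nat.one_le_floor_iff, ← hs]
    calc (1 : ℝ) = Real.exp (Real.log L0) * Real.exp (-Real.log L0) := by
          rw [← Real.exp_add]; simp
      _ ≤ L0 * Real.exp (-s) := by
          rw [Real.exp_log hL0]; gcongr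
  have hL : 36 ≤ Lof L0 := by unfold Lof; omega
  have hLpos : (0 : ℝ) < Lof L0 := by exact_mod_cast (by omega : 0 < Lof L0)
  refine ⟨hL, ?_⟩
  rw [Real.le_log_iff_exp_le (by positivity), le_div_iff₀ hLpos]
  have hMle : (Mof L0 : ℝ) ≤ L0 * Real.exp (-s) := Nat.floor_le (by positivity)
  have he : Real.exp 1 * 1000 ≤ Real.exp s := by
    have h2 : (2.7 : ℝ) ≤ Real.exp 1 := by linarith [Real.exp_one_gt_d9]
    have h3 : Real.exp 1 ≤ 3 := by linarith [Real.exp_one_lt_d9]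
    calc Real.exp 1 * 1000 ≤ (2.7 : ℝ) ^ 10 := by linarith [show (3000 : ℝ) ≤ 2.7 ^ 10 by norm_num]
      _ ≤ Real.exp 1 ^ 10 := by gcongr
      _ = Real.exp 10 := by rw [← Real.exp_nat_mul]; norm_num
      _ ≤ Real.exp s := Real.exp_le_exp.2 hs10
  calc Real.exp 1 * (Lof L0 : ℝ) = Real.exp 1 * 1000 * Mof L0 := by
        unfold Lof; push_cast; ring
    _ ≤ Real.exp s * (L0 * Real.exp (-s)) := by gcongr
    _ = L0 * (Real.exp s * Real.exp (-s)) := by ring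
    _ = L0 := by rw [← Real.exp_add]; simp

/-- **Khashminskii-type exponential bound** (Lemma 3.3).
For `L₀ ≥ c` and any admissible choice of `(ℓ_k)_{0 ≤ k < K}`:
`sup_x E_x[exp{(c₈/log(L₀/L)) (log L/L) Σ_{I ∈ 𝒮} 1_{H_I < ∞}}] ≤ 2`. -/
theorem khasminskii_bound (d : ℕ) (hd : 3 ≤ d) :
    ∃ c8 c : ℝ, 0 < c8 ∧ 0 < c ∧
      ∀ L0 : ℕ, c ≤ (L0 : ℝ) →
        ∀ lk : ℕ → ℤ, (∀ k < Kof L0, |lk k| < (K'of L0 : ℤ)) →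
          ∀ (P : Zd d → Measure (ℕ → Zd d)), IsSRW d P →
            ∀ x : Zd d,
              (∫ ω, Real.exp ((c8 / Real.log ((L0 : ℝ) / (Lof L0 : ℝ))) *
                  (Real.log (Lof L0) / (Lof L0 : ℝ)) *
                  ∑ k ∈ Finset.range (Kof L0), ∑ j ∈ Finset.range (Lof L0),
                    ({ω' : ℕ → Zd d | ∃ m : ℕ,
                        ω' m ∈ segSet d L0 k (lk k) (k * Lof L0 + j : ℤ)}.indicator
                      (fun _ => (1 : ℝ)) ω)) ∂(P x)) ≤ 2 := by
  refine ⟨1 / 192, Real.exp 1000, by norm_num, Real.exp_pos _, ?_⟩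
  intro L0 hL0 lk _ P hP x
  obtain ⟨hL, hlogq⟩ := scale_bounds hL0
  set L := Lof L0 with hLdef
  have hLr : (36 : ℝ) ≤ L := by exact_mod_cast hL
  have hLpos : (0 : ℝ) < L := by linarith
  have hlogL : 0 < Real.log L := Real.log_pos (by linarith)
  set q := Real.log ((L0 : ℝ) / L) with hq
  have hLL0 : (L : ℝ) ≤ L0 := by
    have h1 : 1 ≤ (L0 : ℝ) / L := by
      by_contra! hlt
      have := Real.log_nonpos (by positivity) hlt.le
      linarith
    rwa [one_le_div hLpos] at h1
  have hL0pos : (0 : ℝ) < L0 := hLpos.trans_le hLL0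
  have hK : 1 ≤ Kof L0 := by
    have : L ≤ L0 := by exact_mod_cast hLL0
    exact (Nat.one_le_div_iff (by omega)).2 (by omega)
  have hlogK : Real.log (Kof L0) ≤ 1 + q := by
    have hKle : (Kof L0 : ℝ) ≤ 2 * (L0 / L) := by
      have h1 : (Kof L0 : ℝ) ≤ ((2 * L0 : ℕ) : ℝ) / L := Nat.cast_div_le
      push_cast at h1
      rwa [mul_div_assoc] at h1
    have hK0 : (0 : ℝ) < Kof L0 := by exact_mod_cast hK
    calc _ ≤ Real.log (2 * (L0 / L)) := Real.log_le_log hK0 hKle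
      _ = Real.log 2 + q := Real.log_mul two_ne_zero (by positivity)
      _ ≤ 1 + q := by linarith [Real.log_two_lt_d9]
  set l := 1 / 192 / q * (Real.log L / L) with hl
  have hl0 : 0 ≤ l := by positivity
  have key := hP.integral_exp_sum_indicator_le (by omega)
    (s := Finset.range (Kof L0) ×ˢ Finset.range L)
    (S := fun i => segSet d L0 i.1 (lk i.1) (i.1 * L + i.2 : ℤ))
    (h := fun i y => 2 / Real.log L * segmentPotential L (i.1 * L + i.2) (lk i.1 * Mof L0) y)
    (l := l) hl0 (fun i y => mul_nonneg (by positivity) (segmentPotential_nonneg _ _ _ _))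
    ?_ ?_ ?_ x
  · simpa only [Finset.sum_product] using key
  · intro i y
    rw [← Finset.mul_sum, mul_left_comm]
    gcongr
    exact isSuperharmonic_segmentPotential hd _ _ _ y
  · rintro i - y ⟨⟨hplane, -, -, h1, h2⟩, h0⟩
    have := half_log_le_segmentPotential hL hplane h0 h1 h2
    calc (1 : ℝ) = 2 / Real.log L * (Real.log L / 2) := by field_simp
      _ ≤ _ := by gcongr
  · intro y
    have hsum := sum_segmentPotential_le hK (by omega : 1 ≤ L) (fun k => lk k * Mof L0) y
    rw [← Finset.mul_sum, Finset.sum_product]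
    calc _ ≤ 2 * l * (2 / Real.log L * (L * (32 + 8 * Real.log (Kof L0)))) := by gcongr
      _ ≤ 2 * l * (2 / Real.log L * (L * (48 * q))) := by
          gcongr
          linarith
      _ = 1 := by
          rw [hl]
          field_simp
          norm_num
end
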